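/- arXiv:math/0608768 — 3 statements merged into one kernel-verified Lean document; each statement's English description precedes it below -/
import Mathlib

section
/- Let G be a group, A and B finite subgroups of G, and φ : A ≃* B an isomorphism. Suppose that B has at least 3 left cosets in G (index at least 3, infinite index allowed), and that there exists g ∈ G such that either (for all a ∈ A, g⁻¹·a·g ∈ A implies a = 1) or (for all a ∈ A, g⁻¹·a·g ∈ B implies a = 1). Then there is an injective group homomorphism from the free product Monoid.Coprod G (FreeGroup (Fin 2)) into the HNN extension HNNExtension G A B φ whose composition with the left injection G →* Monoid.Coprod G (FreeGroup (Fin 2)) equals the canonical embedding of : G →* HNNExtension G A B φ. In particular, the HNN extension contains a copy of G ∗ F₂. -/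
/-- A ping-pong lemma for free groups which locates the images of points under all nontrivial
elements. The set `X (i, true)` attracts for `a i` and the set `X (i, false)` for `(a i)⁻¹`. -/
theorem FreeGroup.lift_smul_mem_of_ping_pong {ι H α : Type*} [Group H] [MulAction H α]
    (a : ι → H) (X : ι × Bool → Set α) (D : Set α)
    (hXD : ∀ k, X k ⊆ D) (hdisj : ∀ k l, k ≠ l → ∀ x ∈ X k, x ∉ X l)
    (hX : ∀ i b, ∀ x ∉ X (i, !b), (cond b (a i) (a i)⁻¹) • x ∈ X (i, b))
    (w : FreeGroup ι) (hw : w ≠ 1) (x : α) (hx : x ∉ D) :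
    FreeGroup.lift a w • x ∈ D := by
  classical
  have key : ∀ (L : List (ι × Bool)) (k : ι × Bool), FreeGroup.IsReduced (k :: L) →
      FreeGroup.lift a (FreeGroup.mk (k :: L)) • x ∈ X k := by
    intro L
    induction L with
    | nil =>
      rintro ⟨i, b⟩ -
      simpa using hX i b x fun h => hx (hXD _ h)
    | cons l L ih =>
      rintro ⟨i, b⟩ h
      rw [FreeGroup.IsReduced, List.isChain_cons_cons] at h
      have h1 := hX i b _ (hdisj l (i, !b) ?_ _ (ih l h.2))
      · simpa [FreeGroup.lift_mk, mul_smul] using h1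
      · rintro rfl
        simpa using h.1 rfl
  rw [← FreeGroup.mk_toWord (x := w)]
  have hred := FreeGroup.isReduced_toWord (x := w)
  have hne : w.toWord ≠ [] := fun h => hw (FreeGroup.toWord_eq_nil_iff.1 h)
  generalize w.toWord = L at hred hne
  cases L with
  | nil => exact absurd rfl hne
  | cons k L => exact hXD _ (key L k hred)

/-- A version of the ping-pong lemma for a free product of two groups, one of which is infinite,
in which the two groups are identified with the members of a family indexed by `Bool`. -/
theorem Monoid.Coprod.lift_injective_of_ping_pong_of_mulEquiv {G F H α : Type*} {M : Bool → Type*}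
    [Group G] [Group F] [∀ b, Group (M b)] (e₁ : G ≃* M false) (e₂ : F ≃* M true)
    [Infinite F] [Group H] [MulAction H α] (f : G →* H) (g : F →* H) (X Y : Set α)
    (hX : X.Nonempty) (hY : Y.Nonempty) (hXY : Disjoint X Y)
    (hf : ∀ a, a ≠ 1 → ∀ y ∈ Y, f a • y ∈ X) (hg : ∀ a, a ≠ 1 → ∀ x ∈ X, g a • x ∈ Y) :
    Function.Injective (Monoid.Coprod.lift f g) := by
  let k : ∀ b, M b →* H :=
    Bool.rec (f.comp e₁.symm.toMonoidHom) (g.comp e₂.symm.toMonoidHom)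
  let r : ∀ b, M b →* Monoid.Coprod G F :=
    Bool.rec (inl.comp e₁.symm.toMonoidHom) (inr.comp e₂.symm.toMonoidHom)
  let i : Monoid.Coprod G F →* Monoid.CoprodI M :=
    Monoid.Coprod.lift (Monoid.CoprodI.of.comp e₁.toMonoidHom)
      (Monoid.CoprodI.of.comp e₂.toMonoidHom)
  have hk : Function.Injective (Monoid.CoprodI.lift k) := by
    refine Monoid.CoprodI.lift_injective_of_ping_pong k (Or.inr ⟨true, ?_⟩)
      (fun b => cond b Y X) ?_ ?_ ?_
    · have : Infinite (M true) := e₂.toEquiv.infinite_iff.1 inferInstance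
      exact (Cardinal.natCast_lt_aleph0 (n := 3)).le.trans (Cardinal.aleph0_le_mk (M true))
    · rintro (_ | _)
      exacts [hX, hY]
    · rintro (_ | _) (_ | _) h
      exacts [absurd rfl h, hXY, hXY.symm, absurd rfl h]
    · rintro (_ | _) (_ | _) h a ha _ ⟨x, hx, rfl⟩
      · exact absurd rfl h
      · exact hf (e₁.symm a) (by simpa using ha) x hx
      · exact hg (e₂.symm a) (by simpa using ha) x hx
      · exact absurd rfl h
  have hr : (Monoid.CoprodI.lift r).comp i = MonoidHom.id _ := by
    apply hom_ext <;> ext x <;> simp [i, r]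
  have hi : Function.Injective i :=
    Function.LeftInverse.injective (g := Monoid.CoprodI.lift r) fun x => DFunLike.congr_fun hr x
  have hki : Monoid.Coprod.lift f g = (Monoid.CoprodI.lift k).comp i := by
    apply hom_ext <;> ext x <;> simp [i, k]
  rw [hki, MonoidHom.coe_comp]
  exact hk.comp hi

/-- The ping-pong lemma for a free product of two groups, one of which is infinite. -/
theorem Monoid.Coprod.lift_injective_of_ping_pong {G F H α : Type*} [Group G] [Group F]
    [Infinite F] [Group H] [MulAction H α] (f : G →* H) (g : F →* H) (X Y : Set α)
    (hX : X.Nonempty) (hY : Y.Nonempty) (hXY : Disjoint X Y)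
    (hf : ∀ a, a ≠ 1 → ∀ y ∈ Y, f a • y ∈ X) (hg : ∀ a, a ≠ 1 → ∀ x ∈ X, g a • x ∈ Y) :
    Function.Injective (Monoid.Coprod.lift f g) := by
  let M : Bool → Type _ := fun b => cond b (ULift.{max u_1 u_2} F) (ULift.{max u_1 u_2} G)
  let inst : ∀ b, Group (M b) := Bool.rec ULift.group ULift.group
  let e₁ : G ≃* M false := MulEquiv.ulift.symm
  let e₂ : F ≃* M true := MulEquiv.ulift.symm
  exact lift_injective_of_ping_pong_of_mulEquiv e₁ e₂ f g X Y hX hY hXY hf hg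

/-- A subgroup which has neither index one nor index two has at least three left cosets. -/
theorem Subgroup.exists_notMem_of_index_ne {G : Type*} [Group G] (B : Subgroup G)
    (h₁ : B.index ≠ 1) (h₂ : B.index ≠ 2) :
    ∃ b₁ b₂ : G, b₁ ∉ B ∧ b₂ ∉ B ∧ b₁⁻¹ * b₂ ∉ B := by
  obtain ⟨b₁, hb₁⟩ : ∃ b, b ∉ B := by
    by_contra! h
    exact h₁ (Subgroup.index_eq_one.2 (eq_top_iff.2 fun x _ => h x))
  by_contra! h
  refine h₂ (Subgroup.index_eq_two_iff.2 ⟨b₁, fun b => ?_⟩)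
  by_cases hb : b ∈ B
  · exact Or.inr ⟨hb, fun h' => hb₁ ((B.mul_mem_cancel_left hb).1 h')⟩
  · refine Or.inl ⟨?_, hb⟩
    simpa using B.inv_mem (h b₁ b⁻¹ hb₁ (by simpa using hb))

namespace HNNExtension

open NormalWord

variable {G : Type*} [Group G] {A B : Subgroup G} {φ : A ≃* B} {d : TransversalPair G A B}

theorem cancels_of_smul_iff {u : ℤˣ} {w : NormalWord d} (hw : Cancels u w) (g : G) :
    Cancels u ((of g : HNNExtension G A B φ) • w) ↔ g ∈ toSubgroup A B u := by
  rw [of_smul_eq_smul]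
  simp only [Cancels, group_smul_head, group_smul_toList, hw.2, and_true]
  exact Subgroup.mul_mem_cancel_right _ hw.1

theorem not_cancels_neg_of_smul {u : ℤˣ} {w : NormalWord d} (hw : Cancels u w) (g : G) :
    ¬ Cancels (-u) ((of g : HNNExtension G A B φ) • w) := by
  rw [of_smul_eq_smul]
  rintro ⟨-, h⟩
  rw [group_smul_toList, hw.2] at h
  simp at h

theorem cancels_neg_one_t_smul_iff (w : NormalWord d) :
    Cancels (-1) ((t : HNNExtension G A B φ) • w) ↔ ¬ Cancels 1 w := by
  rw [t_smul_eq_unitsSMul]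
  exact unitsSMul_cancels_iff φ 1 w

theorem not_cancels_empty (u : ℤˣ) : ¬ Cancels u (empty : NormalWord d) := by
  simp [Cancels]

theorem exists_cancels_one (φ : A ≃* B) : ∃ w : NormalWord d, Cancels 1 w := by
  refine ⟨(t : HNNExtension G A B φ)⁻¹ • empty, ?_⟩
  by_contra h
  rw [← cancels_neg_one_t_smul_iff (φ := φ), smul_inv_smul] at h
  exact not_cancels_empty _ h

/-- Some translate of the half-space `{w | Cancels 1 w}` is moved off itself by every nontrivial
element of `G`. -/
theorem exists_translate_not_cancels (φ : A ≃* B) (d : TransversalPair G A B)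
    (hg : ∃ g : G, (∀ a ∈ A, g⁻¹ * a * g ∈ A → a = 1) ∨
      (∀ a ∈ A, g⁻¹ * a * g ∈ B → a = 1)) :
    ∃ p : HNNExtension G A B φ, ∀ g : G, g ≠ 1 → ∀ w : NormalWord d,
      Cancels 1 (p • w) → ¬ Cancels 1 (p • (of g : HNNExtension G A B φ) • w) := by
  obtain ⟨k, hk⟩ := hg
  by_cases hkA : k ∉ A ∧ ∀ a ∈ A, k⁻¹ * a * k ∈ A → a = 1
  · obtain ⟨hkA, hk⟩ := hkA
    refine ⟨of k⁻¹ * t⁻¹, fun g hg1 w hw hgw => hg1 ?_⟩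
    have aux : ∀ v : NormalWord d,
        Cancels 1 ((of k⁻¹ * t⁻¹ : HNNExtension G A B φ) • v) → Cancels (-1) v := by
      intro v hv
      rw [mul_smul] at hv
      rw [← smul_inv_smul (t : HNNExtension G A B φ) v, cancels_neg_one_t_smul_iff]
      intro h
      exact hkA (by simpa using (cancels_of_smul_iff h _).1 hv)
    have hgB : g ∈ B := (cancels_of_smul_iff (aux w hw) g).1 (aux _ hgw)
    have hcomm := inv_t_mul_of (φ := φ) ⟨g, hgB⟩
    have heq : (of k⁻¹ * t⁻¹ : HNNExtension G A B φ) • (of g : HNNExtension G A B φ) • w =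
        (of (k⁻¹ * φ.symm ⟨g, hgB⟩ * k) : HNNExtension G A B φ) •
          (of k⁻¹ * t⁻¹ : HNNExtension G A B φ) • w := by
      simp only [← mul_smul]
      rw [mul_assoc, hcomm]
      simp [mul_assoc]
    rw [heq] at hgw
    have h1 := hk _ (φ.symm ⟨g, hgB⟩).2 ((cancels_of_smul_iff hw _).1 hgw)
    simpa using h1
  · obtain ⟨k, hk⟩ : ∃ k : G, ∀ a ∈ A, k⁻¹ * a * k ∈ B → a = 1 := by
      refine hk.elim (fun h => ⟨1, fun a ha _ => h a ha ?_⟩) fun h => ⟨k, h⟩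
      have hkA : k ∈ A := by
        by_contra hkA'
        exact hkA ⟨hkA', h⟩
      exact A.mul_mem (A.mul_mem (A.inv_mem hkA) ha) hkA
    refine ⟨of k * t, fun g hg1 w hw hgw => hg1 ?_⟩
    have aux : ∀ v : NormalWord d,
        Cancels 1 ((of k * t : HNNExtension G A B φ) • v) → Cancels 1 v := by
      intro v hv
      rw [mul_smul] at hv
      by_contra h
      rw [← cancels_neg_one_t_smul_iff (φ := φ)] at h
      exact not_cancels_neg_of_smul h k (by simpa using hv)
    have hgA : g ∈ A := (cancels_of_smul_iff (aux w hw) g).1 (aux _ hgw)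
    have hcomm := t_mul_of (φ := φ) ⟨g, hgA⟩
    have heq : (of k * t : HNNExtension G A B φ) • (of g : HNNExtension G A B φ) • w =
        (of (k * φ ⟨g, hgA⟩ * k⁻¹) : HNNExtension G A B φ) •
          (of k * t : HNNExtension G A B φ) • w := by
      simp only [← mul_smul]
      rw [mul_assoc, hcomm]
      simp [mul_assoc]
    rw [heq] at hgw
    have h1 := hk _ ((cancels_of_smul_iff hw _).1 hgw) (by simp [mul_assoc])
    simpa using h1

/-- If `B` has at least three left cosets and `A` at least two, there is a homomorphism from the
free group of rank two whose nontrivial values map the complement of the half-space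
`{w | Cancels 1 w}` into it. -/
theorem exists_freeGroup_hom_cancels (φ : A ≃* B) (d : TransversalPair G A B)
    (hA : ∃ a, a ∉ A) (hB : ∃ b₁ b₂ : G, b₁ ∉ B ∧ b₂ ∉ B ∧ b₁⁻¹ * b₂ ∉ B) :
    ∃ f : FreeGroup (Fin 2) →* HNNExtension G A B φ, ∀ x, x ≠ 1 → ∀ w : NormalWord d,
      ¬ Cancels 1 w → Cancels 1 (f x • w) := by
  obtain ⟨a₂, ha₂⟩ := hA
  obtain ⟨b₁, b₂, hb₁, hb₂, hb⟩ := hB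
  let a : Fin 2 → G := ![1, a₂]
  let b : Fin 2 → G := ![b₁, b₂]
  have ha : ∀ i j, i ≠ j → (a j)⁻¹ * a i ∉ A := by
    intro i j hij
    fin_cases i <;> fin_cases j <;> simp_all [a]
  have hb' : b₂⁻¹ * b₁ ∉ B := fun h => hb (by simpa using B.inv_mem h)
  have hbd : ∀ i j, i ≠ j → (b j)⁻¹ * b i ∉ B := by
    intro i j hij
    fin_cases i <;> fin_cases j <;> simp_all [b]
  have hbB : ∀ i, b i ∉ B := by
    intro i
    fin_cases i <;> simp_all [b]
  -- the attracting half-spaces of the generators and of their inverses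
  let s : Fin 2 × Bool → G := fun k => cond k.2 (b k.1) (a k.1)
  let u : Fin 2 × Bool → ℤˣ := fun k => cond k.2 (-1) 1
  let X : Fin 2 × Bool → Set (NormalWord d) := fun k =>
    {w | Cancels (u k) ((of (s k)⁻¹ * t : HNNExtension G A B φ) • w)}
  let c : Fin 2 → HNNExtension G A B φ := fun i =>
    (of (b i)⁻¹ * t)⁻¹ * t * (of (a i)⁻¹ * t)
  have hXmem : ∀ k w, w ∈ X k ↔
      Cancels (u k) ((of (s k)⁻¹ * t : HNNExtension G A B φ) • w) := fun _ _ => Iff.rfl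
  have hmove : ∀ (k l) (w : NormalWord d),
      (of (s l)⁻¹ * t : HNNExtension G A B φ) • w =
        (of ((s l)⁻¹ * s k) : HNNExtension G A B φ) •
          (of (s k)⁻¹ * t : HNNExtension G A B φ) • w := by
    intro k l w
    simp [← mul_smul, mul_assoc]
  have hmove' : ∀ (k) (w : NormalWord d), (t : HNNExtension G A B φ) • w =
      (of (s k) : HNNExtension G A B φ) • (of (s k)⁻¹ * t : HNNExtension G A B φ) • w := by
    intro k w
    simp [← mul_smul]
  refine ⟨FreeGroup.lift c, fun x hx w hw => FreeGroup.lift_smul_mem_of_ping_pong c X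
    {w | Cancels 1 w} ?_ ?_ ?_ x hx w hw⟩
  · rintro ⟨i, e⟩ v hv
    rw [hXmem] at hv
    by_contra h
    rw [Set.mem_ofPred_eq, ← cancels_neg_one_t_smul_iff (φ := φ), hmove' (i, e)] at h
    cases e
    · exact not_cancels_neg_of_smul (u := 1) hv _ h
    · exact hbB i ((cancels_of_smul_iff (u := -1) hv _).1 h)
  · rintro ⟨i, e⟩ ⟨j, e'⟩ hne v hv hv'
    rw [hXmem] at hv hv'
    rw [hmove (i, e) (j, e')] at hv'
    cases e <;> cases e'
    · exact ha i j (by simpa using hne) ((cancels_of_smul_iff (u := 1) hv _).1 hv')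
    · exact not_cancels_neg_of_smul (u := 1) hv _ hv'
    · exact not_cancels_neg_of_smul (u := -1) hv _ (by rwa [neg_neg])
    · exact hbd i j (by simpa using hne) ((cancels_of_smul_iff (u := -1) hv _).1 hv')
  · rintro i (_ | _) v hv
    · change Cancels 1 ((of (a i)⁻¹ * t : HNNExtension G A B φ) • (c i)⁻¹ • v)
      have hv' : ¬ Cancels (-1) ((of (b i)⁻¹ * t : HNNExtension G A B φ) • v) := hv
      by_contra h
      rw [← cancels_neg_one_t_smul_iff (φ := φ)] at h
      apply hv'
      convert h using 1
      simp [c, ← mul_smul, mul_assoc]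
    · change Cancels (-1) ((of (b i)⁻¹ * t : HNNExtension G A B φ) • c i • v)
      have hv' : ¬ Cancels 1 ((of (a i)⁻¹ * t : HNNExtension G A B φ) • v) := hv
      rw [← cancels_neg_one_t_smul_iff (φ := φ)] at hv'
      convert hv' using 1
      simp [c, ← mul_smul, mul_assoc]

end HNNExtension

open HNNExtension HNNExtension.NormalWord in
/-- If `A`, `B` are finite subgroups of `G` with `φ : A ≃* B`, `B` has index at least 3
(infinite index allowed), and some `g ∈ G` conjugates `A` off `A` or off `B`, then the
HNN extension of `G` along `φ` contains a copy of `G ∗ F₂` extending the canonical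
copy of `G`. -/
theorem hnnExtension_contains_coprod_freeGroup
    {G : Type*} [Group G] (A B : Subgroup G)
    (hAfin : (A : Set G).Finite) (hBfin : (B : Set G).Finite)
    (φ : A ≃* B)
    (hidx : B.index = 0 ∨ 3 ≤ B.index)
    (hg : ∃ g : G, (∀ a ∈ A, g⁻¹ * a * g ∈ A → a = 1) ∨
                   (∀ a ∈ A, g⁻¹ * a * g ∈ B → a = 1)) :
    ∃ ψ : Monoid.Coprod G (FreeGroup (Fin 2)) →* HNNExtension G A B φ,
      Function.Injective ψ ∧
      ψ.comp Monoid.Coprod.inl = HNNExtension.of := by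
  have hA : ∃ a, a ∉ A := by
    by_contra! h
    have hAtop : A = ⊤ := eq_top_iff.2 fun x _ => h x
    subst hAtop
    have : Finite G := Set.finite_univ_iff.1 (by simpa using hAfin)
    have hcard : Nat.card B = Nat.card G := by
      rw [← Nat.card_congr φ.toEquiv, Subgroup.card_top]
    rw [Subgroup.eq_top_of_card_eq B hcard, Subgroup.index_top] at hidx
    omega
  have hB := B.exists_notMem_of_index_ne (by omega) (by omega)
  obtain ⟨d⟩ := TransversalPair.nonempty G A B
  obtain ⟨p, hp⟩ := exists_translate_not_cancels φ d hg
  obtain ⟨f, hf⟩ := exists_freeGroup_hom_cancels φ d hA hB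
  obtain ⟨w, hw⟩ := exists_cancels_one (d := d) φ
  refine ⟨Monoid.Coprod.lift of ((MulAut.conj p⁻¹).toMonoidHom.comp f), ?_,
    Monoid.Coprod.lift_comp_inl _ _⟩
  refine Monoid.Coprod.lift_injective_of_ping_pong _ _ {w : NormalWord d | ¬ Cancels 1 (p • w)}
    {w | Cancels 1 (p • w)} ⟨p⁻¹ • empty, ?_⟩ ⟨p⁻¹ • w, ?_⟩ ?_ hp ?_
  · simpa using not_cancels_empty 1
  · simpa using hw
  · exact Set.disjoint_left.2 fun _ h h' => h h'
  · intro x hx v hv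
    simpa [mul_smul] using hf x hx _ hv
end

section
/- Let G be a group, Q a finite type with decidable equality (the states of a finite automaton), δ a finite subset of Q × G × Q (the transitions, labelled by group elements), and q₀ ≠ q_f in Q. Work in the free product P = Monoid.Coprod G (FreeGroup Q); for g ∈ G write ĝ = inl g and for q ∈ Q write q̃ = inr (FreeGroup.of q). Let Δ = { q̃ · ĝ · p̃⁻¹ : (q,g,p) ∈ δ } ⊆ P. Then for every t ∈ G: the element q̃₀ · t̂ · q̃_f⁻¹ belongs to the submonoid Submonoid.closure Δ of P if and only if t is the label product of some accepting path, i.e. there exist n ≥ 1, states r₀ = q₀, r₁, …, rₙ = q_f and elements g₁, …, gₙ ∈ G with (r_{i-1}, g_i, r_i) ∈ δ for all i and t = g₁·g₂⋯gₙ in G. -/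
namespace TransitionWord

variable {G Q : Type*} [Group G]

/-- `LabelledPath δ p g q` says that some nonempty path from `p` to `q` with transitions in `δ`
has label product `g`. -/
inductive LabelledPath (δ : Set (Q × G × Q)) : Q → G → Q → Prop
  | single {p g q} : (p, g, q) ∈ δ → LabelledPath δ p g q
  | cons {p g q h r} : (p, g, q) ∈ δ → LabelledPath δ q h r → LabelledPath δ p (g * h) r

theorem LabelledPath.exists_fin {δ : Set (Q × G × Q)} {p q : Q} {t : G}
    (h : LabelledPath δ p t q) :
    ∃ (n : ℕ) (_ : 1 ≤ n) (r : Fin (n + 1) → Q) (gs : Fin n → G),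
      r 0 = p ∧ r (Fin.last n) = q ∧
      (∀ i : Fin n, (r i.castSucc, gs i, r i.succ) ∈ δ) ∧
      (List.ofFn gs).prod = t := by
  induction h with
  | @single p g q h =>
    exact ⟨1, le_rfl, ![p, q], ![g], rfl, rfl, fun i => by fin_cases i; exact h, by simp⟩
  | @cons p g q h r hδ _ ih =>
    obtain ⟨n, _, rs, gs, h0, hlast, hstep, hprod⟩ := ih
    refine ⟨n + 1, by omega, Fin.cons p rs, Fin.cons g gs, rfl, ?_, fun i => ?_, ?_⟩
    · rw [← Fin.succ_last, Fin.cons_succ, hlast]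
    · refine Fin.cases ?_ (fun j => ?_) i
      · simpa [h0] using hδ
      · simpa [← Fin.succ_castSucc] using hstep j
    · simp [List.ofFn_succ, hprod]

/-- The element `q̃ · g · p̃⁻¹` of `G ∗ F(Q)` attached to a triple `(q, g, p)`. -/
def transitionElement (q : Q) (g : G) (p : Q) : Monoid.Coprod G (FreeGroup Q) :=
  Monoid.Coprod.inr (FreeGroup.of q) * Monoid.Coprod.inl g *
    (Monoid.Coprod.inr (FreeGroup.of p))⁻¹

theorem transitionElement_mul (p q r : Q) (g h : G) :
    transitionElement p g q * transitionElement q h r = transitionElement p (g * h) r := by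
  simp [transitionElement, mul_assoc]

theorem transitionElement_mem_of_path (M : Submonoid (Monoid.Coprod G (FreeGroup Q)))
    {δ : Set (Q × G × Q)} (hM : ∀ p g q, (p, g, q) ∈ δ → transitionElement p g q ∈ M)
    (n : ℕ) (r : Fin (n + 2) → Q) (gs : Fin (n + 1) → G)
    (h : ∀ i : Fin (n + 1), (r i.castSucc, gs i, r i.succ) ∈ δ) :
    transitionElement (r 0) (List.ofFn gs).prod (r (Fin.last _)) ∈ M := by
  induction n with
  | zero => simpa using hM _ _ _ (h 0)
  | succ n ih =>
    rw [List.ofFn_succ, List.prod_cons, ← transitionElement_mul _ (r 1)]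
    exact M.mul_mem (hM _ _ _ (h 0))
      (ih (fun i => r i.succ) (fun i => gs i.succ) fun i => h i.succ)

/-- A list of triples `(p, g, q)` is reduced when `p̃₁g₁q̃₁⁻¹p̃₂g₂q̃₂⁻¹⋯` admits no cancellation. -/
def IsReduced : List (Q × G × Q) → Prop
  | [] => True
  | x :: w => IsReduced w ∧ (x.1 = x.2.2 → x.2.1 ≠ 1) ∧ ∀ y ∈ w.head?, y.1 ≠ x.2.2

theorem isReduced_nil : IsReduced ([] : List (Q × G × Q)) := trivial

variable (G Q) in
/-- Reduced lists of triples. -/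
abbrev ClosedWord := {w : List (Q × G × Q) // IsReduced w}

variable (G Q) in
/-- A word `g · q̃⁻¹ · w` with `w` reduced and not starting with `q`. -/
@[ext]
structure OpenWord where
  label : G
  state : Q
  tail : ClosedWord G Q
  head_ne : ∀ y ∈ tail.1.head?, y.1 ≠ state

instance : MulAction G (OpenWord G Q) where
  smul g a := ⟨g * a.label, a.state, a.tail, a.head_ne⟩
  one_smul a := OpenWord.ext (one_mul a.label) rfl rfl
  mul_smul g h a := OpenWord.ext (mul_assoc g h a.label) rfl rfl

theorem smul_mk (g h : G) (q : Q) (w : ClosedWord G Q) (hw) :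
    g • (⟨h, q, w, hw⟩ : OpenWord G Q) = ⟨g * h, q, w, hw⟩ := rfl

open Classical in
/-- Left multiplication of an open word by `p̃`, with cancellation. -/
noncomputable def close (p : Q) (a : OpenWord G Q) : ClosedWord G Q :=
  if h : p = a.state ∧ a.label = 1 then a.tail
  else ⟨(p, a.label, a.state) :: a.tail.1, a.tail.2, fun hp h1 => h ⟨hp, h1⟩, a.head_ne⟩

open Classical in
/-- Left multiplication of a closed word by `p̃⁻¹`, with cancellation. -/
noncomputable def openAt (p : Q) : ClosedWord G Q → OpenWord G Q
  | ⟨[], h⟩ => ⟨1, p, ⟨[], h⟩, by simp⟩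
  | ⟨x :: w, h⟩ =>
    if hx : x.1 = p then ⟨x.2.1, x.2.2, ⟨w, h.1⟩, h.2.2⟩
    else ⟨1, p, ⟨x :: w, h⟩, by simpa using hx⟩

theorem openAt_of_head_ne (p : Q) (w : ClosedWord G Q) (hw : ∀ y ∈ w.1.head?, y.1 ≠ p) :
    openAt p w = ⟨1, p, w, hw⟩ := by
  obtain ⟨_ | ⟨x, w⟩, h⟩ := w
  · rfl
  · have hx : x.1 ≠ p := by simpa using hw
    simp [openAt, hx]

/-- Left multiplication by `p̃` as a bijection from open words to closed words. -/
noncomputable def closeEquiv (p : Q) : OpenWord G Q ≃ ClosedWord G Q where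
  toFun := close p
  invFun := openAt p
  left_inv := by
    rintro ⟨g, q, w, hw⟩
    by_cases h : p = q ∧ g = 1
    · obtain ⟨rfl, rfl⟩ := h
      simpa [close] using openAt_of_head_ne p w hw
    · simp [close, h, openAt]
  right_inv := by
    rintro ⟨_ | ⟨x, w⟩, h⟩
    · simp [openAt, close]
    · by_cases hx : x.1 = p
      · have h1 : ¬(p = x.2.2 ∧ x.2.1 = 1) := fun h' => h.2.1 (hx.trans h'.1) h'.2
        subst hx
        simp [openAt, close, h1]
      · simp [openAt, hx, close]

variable (G Q) in
/-- The action of `G ∗ F(Q)` on open and closed words, where `p̃` carries open words to closed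
words and `G` acts trivially on closed words. -/
noncomputable def wordAction :
    Monoid.Coprod G (FreeGroup Q) →* Equiv.Perm (OpenWord G Q ⊕ ClosedWord G Q) :=
  Monoid.Coprod.lift
    ((Equiv.Perm.sumCongrHom _ _).comp
      ((MonoidHom.inl _ _).comp (MulAction.toPermHom G (OpenWord G Q))))
    (FreeGroup.lift fun p =>
      ((Equiv.sumCongr (closeEquiv p) (closeEquiv p).symm).trans (Equiv.sumComm _ _)))

theorem wordAction_transitionElement (q : Q) (g : G) (p : Q) (w : ClosedWord G Q) :
    wordAction G Q (transitionElement q g p) (Sum.inr w) =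
      Sum.inr (close q (g • openAt p w)) := by
  have hinv : (wordAction G Q (Monoid.Coprod.inr (FreeGroup.of p)))⁻¹ (Sum.inr w) =
      Sum.inl (openAt p w) := by
    rw [Equiv.Perm.inv_eq_iff_eq]
    simp only [wordAction, Monoid.Coprod.lift_apply_inr, FreeGroup.lift_apply_of]
    exact congrArg Sum.inr ((closeEquiv p).apply_symm_apply w).symm
  rw [transitionElement, map_mul, map_mul, map_inv, Equiv.Perm.mul_apply, Equiv.Perm.mul_apply,
    hinv]
  simp only [wordAction, Monoid.Coprod.lift_apply_inr, FreeGroup.lift_apply_of,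
    Monoid.Coprod.lift_apply_inl]
  rfl

/-- Every triple of the word is realised by a path. -/
def IsPathWord (δ : Set (Q × G × Q)) (w : ClosedWord G Q) : Prop :=
  ∀ x ∈ w.1, LabelledPath δ x.1 x.2.1 x.2.2

theorem IsPathWord.close {δ : Set (Q × G × Q)} {q : Q} {a : OpenWord G Q}
    (hw : IsPathWord δ a.tail) (ha : LabelledPath δ q a.label a.state) :
    IsPathWord δ (close q a) := by
  unfold TransitionWord.close
  split_ifs
  · exact hw
  · exact List.forall_mem_cons.2 ⟨ha, hw⟩

theorem IsPathWord.close_smul_openAt {δ : Set (Q × G × Q)} {q p : Q} {g : G}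
    (hδ : (q, g, p) ∈ δ) {w : ClosedWord G Q} (hw : IsPathWord δ w) :
    IsPathWord δ (TransitionWord.close q (g • openAt p w)) := by
  by_cases hp : ∀ y ∈ w.1.head?, y.1 ≠ p
  · rw [openAt_of_head_ne p w hp, smul_mk, mul_one]
    exact IsPathWord.close hw (.single hδ)
  · obtain ⟨_ | ⟨x, w⟩, h⟩ := w
    · simp at hp
    · have hx : x.1 = p := by simpa using hp
      subst hx
      obtain ⟨hx, hw⟩ := List.forall_mem_cons.1 hw
      simp only [openAt, dif_pos, smul_mk]
      exact IsPathWord.close hw (.cons hδ hx)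

theorem close_smul_openAt_nil {p q : Q} (hpq : p ≠ q) (g : G) :
    (close p (g • openAt q (⟨[], isReduced_nil⟩ : ClosedWord G Q))).1 = [(p, g, q)] := by
  have hnil : ∀ y ∈ (⟨[], isReduced_nil⟩ : ClosedWord G Q).1.head?, y.1 ≠ q := by simp
  rw [openAt_of_head_ne q _ hnil, smul_mk]
  simp [close, hpq]

/-- The submonoid of elements that preserve the closed words all of whose triples are paths. -/
def pathStabilizer (δ : Set (Q × G × Q)) : Submonoid (Monoid.Coprod G (FreeGroup Q)) where
  carrier := {x | ∀ w, IsPathWord δ w →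
    ∃ w', IsPathWord δ w' ∧ wordAction G Q x (Sum.inr w) = Sum.inr w'}
  one_mem' w hw := ⟨w, hw, by simp⟩
  mul_mem' {x y} hx hy w hw := by
    obtain ⟨w₁, hw₁, h₁⟩ := hy w hw
    obtain ⟨w₂, hw₂, h₂⟩ := hx w₁ hw₁
    exact ⟨w₂, hw₂, by rw [map_mul, Equiv.Perm.mul_apply, h₁, h₂]⟩

theorem transitionElement_mem_pathStabilizer {δ : Set (Q × G × Q)} {p q : Q} {g : G}
    (h : (p, g, q) ∈ δ) : transitionElement p g q ∈ pathStabilizer δ :=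
  fun w hw => ⟨_, hw.close_smul_openAt h, wordAction_transitionElement p g q w⟩

theorem labelledPath_of_mem_pathStabilizer {δ : Set (Q × G × Q)} {p q : Q} {g : G}
    (hpq : p ≠ q) (h : transitionElement p g q ∈ pathStabilizer δ) : LabelledPath δ p g q := by
  obtain ⟨w, hw, hact⟩ := h ⟨[], isReduced_nil⟩ (by simp [IsPathWord])
  rw [wordAction_transitionElement, Sum.inr.injEq] at hact
  refine hw (p, g, q) ?_
  rw [← hact, close_smul_openAt_nil hpq]
  exact List.mem_singleton_self _

end TransitionWord

/-- Encoding of finite automata with group-labelled transitions into a submonoid of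
the free product `G ∗ F(Q)`: for `q₀ ≠ q_f`, the element `q̃₀ · t · q̃_f⁻¹` lies in
the submonoid generated by the elements `q̃ · g · p̃⁻¹` for transitions `(q,g,p) ∈ δ`
if and only if `t` is the label product of an accepting path from `q₀` to `q_f`. -/
theorem mem_submonoid_closure_transition_iff_acceptingPath
    {G Q : Type*} [Group G] [Fintype Q] [DecidableEq Q]
    (δ : Set (Q × G × Q)) (hδ : δ.Finite) (q₀ qf : Q) (hq : q₀ ≠ qf) (t : G) :
    (Monoid.Coprod.inr (FreeGroup.of q₀) * Monoid.Coprod.inl t *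
        (Monoid.Coprod.inr (FreeGroup.of qf))⁻¹ ∈
      Submonoid.closure { x : Monoid.Coprod G (FreeGroup Q) |
        ∃ p ∈ δ, x = Monoid.Coprod.inr (FreeGroup.of p.1) * Monoid.Coprod.inl p.2.1 *
          (Monoid.Coprod.inr (FreeGroup.of p.2.2))⁻¹ })
    ↔ ∃ (n : ℕ) (_ : 1 ≤ n) (r : Fin (n + 1) → Q) (gs : Fin n → G),
        r 0 = q₀ ∧ r (Fin.last n) = qf ∧
        (∀ i : Fin n, (r i.castSucc, gs i, r i.succ) ∈ δ) ∧
        (List.ofFn gs).prod = t := by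
  constructor
  · intro h
    refine (TransitionWord.labelledPath_of_mem_pathStabilizer hq
      (Submonoid.closure_le.2 ?_ h)).exists_fin
    rintro _ ⟨p, hp, rfl⟩
    exact TransitionWord.transitionElement_mem_pathStabilizer hp
  · rintro ⟨n, hn, r, gs, rfl, rfl, hstep, rfl⟩
    obtain ⟨n, rfl⟩ := Nat.exists_eq_add_of_le' hn
    refine TransitionWord.transitionElement_mem_of_path (Submonoid.closure _) (δ := δ)
      (fun p g q hp => Submonoid.subset_closure ?_) n r gs hstep
    exact ⟨(p, g, q), hp, rfl⟩
end

section
/- Let A be a finite group with injective, non-surjective homomorphisms ι₁ : A →* G and ι₂ : A →* H into finitely generated groups G and H (so A is a proper subgroup of both). Suppose there exist g ∈ G with g⁻¹·(range ι₁)·g ∩ (range ι₁) = {1} and h ∈ H with h⁻¹·(range ι₂)·h ∩ (range ι₂) = {1}. Let P = G ∗_A H be the amalgamated free product, Δ a finite type with decidable equality, and e : List Δ → P a surjective monoid homomorphism. Then the following are equivalent: (i) for every finite set W of words in List Δ, the predicate w ↦ (e w ∈ Submonoid.closure (e '' W)) is computable (ComputablePred); (ii) for every regular language L ⊆ List Δ,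 the predicate w ↦ (e w ∈ e '' L) is computable. (The submonoid membership problem and the rational subset membership problem for G ∗_A H are recursively equivalent.) -/
/-- The amalgamation relators `inl (ι₁ a) * (inr (ι₂ a))⁻¹` in the free product. -/
def AmalgRels {A G H : Type*} [Group A] [Group G] [Group H]
    (ι₁ : A →* G) (ι₂ : A →* H) : Set (Monoid.Coprod G H) :=
  { x | ∃ a : A, x = Monoid.Coprod.inl (ι₁ a) * (Monoid.Coprod.inr (ι₂ a))⁻¹ }

/-- The amalgamated free product `G ∗_A H` along `ι₁ : A →* G` and `ι₂ : A →* H`: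
the quotient of the free product `G ∗ H` by the normal closure of the
amalgamation relators. -/
abbrev AmalgamatedProduct {A G H : Type*} [Group A] [Group G] [Group H]
    (ι₁ : A →* G) (ι₂ : A →* H) : Type _ :=
  Monoid.Coprod G H ⧸ Subgroup.normalClosure (AmalgRels ι₁ ι₂)

/-- The canonical homomorphism `G →* G ∗_A H`. -/
def AmalgamatedProduct.inl {A G H : Type*} [Group A] [Group G] [Group H]
    (ι₁ : A →* G) (ι₂ : A →* H) : G →* AmalgamatedProduct ι₁ ι₂ :=
  (QuotientGroup.mk' (Subgroup.normalClosure (AmalgRels ι₁ ι₂))).comp Monoid.Coprod.inl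

/-- Any finite type with decidable equality is primcodable. -/
noncomputable instance (priority := 50) fintypePrimcodable {α : Type} [Fintype α] [DecidableEq α] :
    Primcodable α :=
  Primcodable.ofEquiv (Fin (Fintype.card α)) (Fintype.equivFin α)

namespace ComputablePred

variable {α β : Type*} [Primcodable α] [Primcodable β]

theorem and' {p q : α → Prop} (hp : ComputablePred p) (hq : ComputablePred q) :
    ComputablePred fun a => p a ∧ q a := by
  obtain ⟨_, hp⟩ := hp
  obtain ⟨_, hq⟩ := hq
  exact Computable.computablePred ((Primrec.and.to_comp.comp hp hq).of_eq fun a => by simp)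

theorem or' {p q : α → Prop} (hp : ComputablePred p) (hq : ComputablePred q) :
    ComputablePred fun a => p a ∨ q a :=
  (hp.not.and' hq.not).not.of_eq fun a => by tauto

theorem const (c : Prop) : ComputablePred fun _ : α => c := by
  classical
  exact Computable.computablePred (Computable.const _)

theorem exists_mem_finset {τ : Type*} {p : τ → α → Prop} (s : Finset τ)
    (h : ∀ t ∈ s, ComputablePred (p t)) : ComputablePred fun a => ∃ t ∈ s, p t a := by
  classical
  induction s using Finset.induction_on with
  | empty => simpa using const False
  | insert t s _ ih =>
    refine ((h t (by simp)).or' (ih fun t' ht' => h t' (by simp [ht']))).of_eq fun a => ?_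
    simp

theorem exists_finite {τ : Type*} [Finite τ] {p : τ → α → Prop}
    (h : ∀ t, ComputablePred (p t)) : ComputablePred fun a => ∃ t, p t a := by
  have := Fintype.ofFinite τ
  exact (exists_mem_finset Finset.univ fun t _ => h t).of_eq fun a => by simp

theorem forall_finite {τ : Type*} [Finite τ] {p : τ → α → Prop}
    (h : ∀ t, ComputablePred (p t)) : ComputablePred fun a => ∀ t, p t a :=
  (exists_finite fun t => (h t).not).not.of_eq fun a => by simp

theorem iff_const {p : α → Prop} (hp : ComputablePred p) (c : Prop) :
    ComputablePred fun a => p a ↔ c :=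
  ((hp.and' (const c)).or' (hp.not.and' (const ¬c))).of_eq fun a => by tauto

theorem comp {p : β → Prop} (hp : ComputablePred p) {f : α → β} (hf : Computable f) :
    ComputablePred fun a => p (f a) := by
  obtain ⟨_, hp⟩ := hp
  exact Computable.computablePred (hp.comp hf)

/-- A predicate that can be read off from any certificate is computable as soon as certificates
always exist and can be recognised. -/
theorem of_certificate {p : α → Prop} {C D : α → β → Prop}
    (hC : ComputablePred fun x : α × β => C x.1 x.2)
    (hD : ComputablePred fun x : α × β => D x.1 x.2)
    (hex : ∀ a, ∃ b, C a b) (hp : ∀ a b, C a b → (p a ↔ D a b)) : ComputablePred p := by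
  classical
  have key : ∀ {C : α → β → Prop}, (ComputablePred fun x : α × β => C x.1 x.2) →
      ComputablePred fun x : α × ℕ => ∃ b, Encodable.decode (α := β) x.2 = some b ∧ C x.1 b := by
    intro C hC
    have h1 : Computable fun x : α × ℕ =>
        ((Encodable.decode (α := β) x.2).map fun b => decide (C x.1 b)).getD false :=
      Computable.option_getD
        (Computable.option_map (Computable.decode.comp Computable.snd)
          (hC.decide.comp ((Computable.fst.comp Computable.fst).pair Computable.snd)).to₂)
        (Computable.const _)
    refine Computable.computablePred (h1.of_eq fun x => ?_)
    cases Encodable.decode (α := β) x.2 <;> simp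
  have hex' : ∀ a, ∃ n, ∃ b, Encodable.decode (α := β) n = some b ∧ C a b := fun a => by
    obtain ⟨b, hb⟩ := hex a
    exact ⟨Encodable.encode b, b, Encodable.encodek b, hb⟩
  have hfind := Computable.find
    (P := fun a n => ∃ b, Encodable.decode (α := β) n = some b ∧ C a b) (key hC) hex'
  refine ((key hD).comp (Computable.id.pair hfind)).of_eq fun a => ?_
  obtain ⟨b, hb, hCb⟩ := Nat.find_spec (hex' a)
  simp only [id, hb, Option.some.injEq, exists_eq_left', hp a b hCb]

end ComputablePred

/-- A function to a `Fin n` is computable if all its fibres are. -/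
theorem Computable.of_fibers {α : Type*} [Primcodable α] {n : ℕ} {f : α → Fin n}
    (h : ∀ t, ComputablePred fun a => f a = t) : Computable f := by
  classical
  have hv : Computable fun a => List.Vector.ofFn fun t => decide (f a = t) :=
    Computable.vector_ofFn fun t => (h t).decide
  rcases isEmpty_or_nonempty (Fin n) with hn | ⟨⟨t₀⟩⟩
  · have : IsEmpty α := ⟨fun a => hn.elim (f a)⟩
    have : Finite α := inferInstance
    exact (Primrec.dom_finite f).to_comp
  have : Finite (List.Vector Bool n) := inferInstance
  have hg : Primrec fun v : List.Vector Bool n =>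
      if hv : ∃ t, v.get t = true then hv.choose else t₀ := Primrec.dom_finite _
  refine (hg.to_comp.comp hv).of_eq fun a => ?_
  have hex : ∃ t, (List.Vector.ofFn fun t => decide (f a = t)).get t = true := ⟨f a, by simp⟩
  rw [dif_pos hex]
  simp

theorem Computable.list_foldl_fin {α : Type*} [Primcodable α] {n : ℕ} {g : Fin n → α → Fin n}
    (h : Computable₂ g) (s : Fin n) : Computable fun l : List α => l.foldl g s := by
  let F : List α → ℕ → Fin n := fun l m => Nat.rec (motive := fun _ => Fin n) s
    (fun k t => ((l[k]?).map fun a => g t a).getD t) m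
  have h1 : Computable fun l : List α => F l l.length := by
    refine Computable.nat_rec (h := fun (l : List α) (x : ℕ × Fin n) =>
      ((l[x.1]?).map fun a => g x.2 a).getD x.2) Computable.list_length (Computable.const s) ?_
    have h2 : Computable fun y : List α × ℕ × Fin n => (y.1[y.2.1]?).map fun a => g y.2.2 a :=
      Computable.option_map
        (Computable.list_getElem?.comp Computable.fst (Computable.fst.comp Computable.snd))
        (h.comp (Computable.snd.comp (Computable.snd.comp Computable.fst)) Computable.snd).to₂
    exact (Computable.option_getD h2 (Computable.snd.comp Computable.snd)).to₂
  refine h1.of_eq fun l => ?_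
  suffices H : ∀ m ≤ l.length, F l m = (l.take m).foldl g s by simpa using H l.length le_rfl
  intro m hm
  induction m with
  | zero => simp [F]
  | succ m ih =>
    have hF : F l (m + 1) = ((l[m]?).map fun a => g (F l m) a).getD (F l m) := rfl
    rw [hF, ih (by omega), List.take_add_one, List.foldl_append]
    simp [List.getElem?_eq_getElem (show m < l.length by omega)]

/-- The value of a right fold with values in a finite type is decidable as soon as each single
step is. -/
theorem ComputablePred.list_foldr {α τ : Type*} [Primcodable α] [Finite τ] {f : α → τ → τ}
    (h : ∀ t t', ComputablePred fun a => f a t = t') (s t : τ) :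
    ComputablePred fun l : List α => l.foldr f s = t := by
  classical
  obtain ⟨n, ⟨e⟩⟩ := Finite.exists_equiv_fin τ
  let g : Fin n → α → Fin n := fun i a => e (f a (e.symm i))
  have hg : Computable₂ g := by
    refine Computable.of_fibers (f := fun x : Fin n × α => g x.1 x.2) fun k => ?_
    have : ComputablePred fun x : Fin n × α => ∃ i, x.1 = i ∧ f x.2 (e.symm i) = e.symm k :=
      ComputablePred.exists_finite fun i =>
        (PrimrecPred.computablePred (Primrec.eq.comp Primrec.fst (Primrec.const i))).and'
          ((h _ _).comp Computable.snd)
    refine this.of_eq fun x => ?_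
    simp [g, Equiv.eq_symm_apply]
  have hfold := (Computable.list_foldl_fin hg (e s)).comp Computable.list_reverse
  have : ∀ l : List α, l.reverse.foldl g (e s) = e (l.foldr f s) := fun l => by
    rw [List.foldl_reverse]
    induction l with
    | nil => rfl
    | cons a l ih => simp [ih, g]
  refine (ComputablePred.comp (p := fun i : Fin n => i = e t)
    (PrimrecPred.computablePred (Primrec.eq.comp Primrec.id (Primrec.const (e t)))) hfold).of_eq
    fun l => ?_
  simp [this]

section GroupTheory

variable {P Q : Type*} [Group P]

/-- `LabelledPath E p x q`: in the graph with edges `E` labelled by group elements, some path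
from `p` to `q` has label product `x`. -/
inductive LabelledPath (E : Set (Q × P × Q)) : Q → P → Q → Prop
  | nil (p : Q) : LabelledPath E p 1 p
  | cons {p q r : Q} {z x : P} : (p, z, q) ∈ E → LabelledPath E q x r →
      LabelledPath E p (z * x) r

namespace LabelledPath

variable {E F : Set (Q × P × Q)} {p q r : Q} {x y : P}

theorem single (h : (p, x, q) ∈ E) : LabelledPath E p x q := by
  simpa using cons h (nil q)

theorem trans (h₁ : LabelledPath E p x q) (h₂ : LabelledPath E q y r) :
    LabelledPath E p (x * y) r := by
  induction h₁ with
  | nil => simpa using h₂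
  | cons h _ ih => rw [mul_assoc]; exact cons h (ih h₂)

theorem bind (h : LabelledPath E p x q)
    (hEF : ∀ p z q, (p, z, q) ∈ E → LabelledPath F p z q) : LabelledPath F p x q := by
  induction h with
  | nil => exact nil _
  | cons h _ ih => exact (hEF _ _ _ h).trans ih

theorem mem_subgroup (h : LabelledPath E p x q) {K : Subgroup P}
    (hE : ∀ p z q, (p, z, q) ∈ E → z ∈ K) : x ∈ K := by
  induction h with
  | nil => exact K.one_mem
  | cons h _ ih => exact K.mul_mem (hE _ _ _ h) ih

end LabelledPath

/-- A list whose entries lie alternately in `K i \ A` and `K (!i) \ A`. -/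
def Alternating (K : Bool → Subgroup P) (A : Subgroup P) : Bool → List P → Prop
  | _, [] => True
  | i, y :: ys => (y ∈ K i ∧ y ∉ A) ∧ Alternating K A (!i) ys

/-- The group `P` is the amalgamated product of its subgroups `K true` and `K false` over their
common subgroup `A`, expressed through reduced words. -/
structure IsAmalgam (K : Bool → Subgroup P) (A : Subgroup P) : Prop where
  base_le : ∀ i, A ≤ K i
  iSup_eq_top : ⨆ i, K i = ⊤
  prod_notMem : ∀ i ys, Alternating K A i ys → ys ≠ [] → ys.prod ∉ A

/-- `x` has a nonempty reduced expression with first letter in `K i` and last letter in `K j`. -/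
inductive HasReducedForm (K : Bool → Subgroup P) (A : Subgroup P) : Bool → Bool → P → Prop
  | single {i : Bool} {x : P} : x ∈ K i → x ∉ A → HasReducedForm K A i i x
  | cons {i j : Bool} {x y : P} : x ∈ K i → x ∉ A → HasReducedForm K A (!i) j y →
      HasReducedForm K A i j (x * y)

namespace HasReducedForm

variable {K : Bool → Subgroup P} {A : Subgroup P} {i j k : Bool} {x y : P}

theorem mul (hx : HasReducedForm K A i j x) (hy : HasReducedForm K A (!j) k y) :
    HasReducedForm K A i k (x * y) := by
  induction hx with
  | single h h' => exact cons h h' hy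
  | cons h h' _ ih => rw [mul_assoc]; exact cons h h' (ih hy)

theorem inv (hx : HasReducedForm K A i j x) : HasReducedForm K A j i x⁻¹ := by
  induction hx with
  | single h h' => exact single (inv_mem h) (by simpa using h')
  | @cons i j x y h h' _ ih =>
    rw [mul_inv_rev]
    exact ih.mul (by simpa using single (i := i) (inv_mem h) (by simpa using h'))

theorem exists_alternating (hx : HasReducedForm K A i j x) :
    ∃ ys, ys ≠ [] ∧ Alternating K A i ys ∧ ys.prod = x := by
  induction hx with
  | @single i x h h' => exact ⟨[x], by simp, by simp [Alternating, h, h'], by simp⟩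
  | @cons i j x y h h' _ ih =>
    obtain ⟨ys, -, hys, rfl⟩ := ih
    exact ⟨x :: ys, by simp, ⟨⟨h, h'⟩, hys⟩, by simp⟩

theorem notMem (hKA : IsAmalgam K A) (hx : HasReducedForm K A i j x) : x ∉ A := by
  obtain ⟨ys, hne, hys, rfl⟩ := hx.exists_alternating
  exact hKA.prod_notMem i ys hys hne

theorem ne_one (hKA : IsAmalgam K A) (hx : HasReducedForm K A i j x) : x ≠ 1 := by
  rintro rfl
  exact hx.notMem hKA A.one_mem

end HasReducedForm

theorem Alternating.hasReducedForm {K : Bool → Subgroup P} {A : Subgroup P} {i : Bool}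
    {ys : List P} (h : Alternating K A i ys) (hne : ys ≠ []) :
    ∃ j, HasReducedForm K A i j ys.prod := by
  induction ys generalizing i with
  | nil => exact absurd rfl hne
  | cons y ys ih =>
    obtain ⟨⟨hy, hyA⟩, h⟩ := h
    rcases eq_or_ne ys [] with rfl | hne'
    · exact ⟨i, by simpa using .single hy hyA⟩
    · obtain ⟨j, hj⟩ := ih h hne'
      exact ⟨j, by simpa using .cons hy hyA hj⟩

/-- The edges with labels in `K i`, saturated by edges for all paths with label in `A`. -/
def sideEdges (K : Bool → Subgroup P) (A : Subgroup P) (E : Set (Q × P × Q)) (i : Bool) :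
    Set (Q × P × Q) :=
  {s | (s.2.1 ∈ K i ∧ s ∈ E) ∨ (s.2.1 ∈ A ∧ LabelledPath E s.1 s.2.1 s.2.2)}

/-- The entries of the list label consecutive paths from `p` to `q`, alternately along the edges
`F i` and `F (!i)`. -/
def AlternatingPath (F : Bool → Set (Q × P × Q)) : Bool → Q → List P → Q → Prop
  | _, p, [], q => p = q
  | i, p, y :: ys, q => ∃ p', LabelledPath (F i) p y p' ∧ AlternatingPath F (!i) p' ys q

/-- As `AlternatingPath`, but for some list obtained from the given one by starting with the
factor `a` and inserting factors `b⁻¹ * b` with `b ∈ A` between the entries. -/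
def TwistedPath (A : Subgroup P) (F : Bool → Set (Q × P × Q)) :
    Bool → Q → P → List P → Q → Prop
  | _, p, a, [], q => p = q ∧ a = 1
  | i, p, a, y :: ys, q => ∃ p', ∃ b ∈ A, LabelledPath (F i) p (a * y * b⁻¹) p' ∧
      TwistedPath A F (!i) p' b ys q

variable {K : Bool → Subgroup P} {A : Subgroup P} {E : Set (Q × P × Q)}

theorem LabelledPath.of_sideEdges {i : Bool} {p q : Q} {x : P}
    (h : LabelledPath (sideEdges K A E i) p x q) : LabelledPath E p x q :=
  h.bind fun _ _ _ h => h.elim (fun h => .single h.2) fun h => h.2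

theorem LabelledPath.mem_of_sideEdges (hKA : IsAmalgam K A) {i : Bool} {p q : Q} {x : P}
    (h : LabelledPath (sideEdges K A E i) p x q) : x ∈ K i :=
  h.mem_subgroup fun _ _ _ h => h.elim (fun h => h.1) fun h => hKA.base_le i h.1

theorem TwistedPath.labelledPath {i : Bool} {p q : Q} {a : P} {ys : List P}
    (h : TwistedPath A (sideEdges K A E) i p a ys q) : LabelledPath E p (a * ys.prod) q := by
  induction ys generalizing i p a with
  | nil =>
    obtain ⟨rfl, rfl⟩ := h
    simpa using LabelledPath.nil p
  | cons y ys ih =>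
    obtain ⟨p', b, -, h, h'⟩ := h
    simpa [mul_assoc] using h.of_sideEdges.trans (ih h')

theorem exists_alternatingPath_mul (hKA : IsAmalgam K A) {p q r : Q} {z x : P} {j : Bool}
    (hz : LabelledPath (sideEdges K A E j) p z q) (hx : LabelledPath E q x r)
    (h : x ∈ A ∨ ∃ i ys, Alternating K A i ys ∧ AlternatingPath (sideEdges K A E) i q ys r ∧
      ys.prod = x) :
    z * x ∈ A ∨ ∃ i ys, Alternating K A i ys ∧ AlternatingPath (sideEdges K A E) i p ys r ∧
      ys.prod = z * x := by
  have hzK := hz.mem_of_sideEdges hKA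
  rcases h with hxA | ⟨i, ys, halt, hpath, rfl⟩
  · by_cases hzx : z * x ∈ A
    · exact .inl hzx
    · exact .inr ⟨j, [z * x], ⟨⟨mul_mem hzK (hKA.base_le j hxA), hzx⟩, trivial⟩,
        ⟨r, hz.trans (.single (.inr ⟨hxA, hx⟩)), rfl⟩, by simp⟩
  · cases ys with
    | nil =>
      by_cases hzA : z ∈ A
      · exact .inl (by simpa using hzA)
      · obtain rfl : q = r := hpath
        exact .inr ⟨j, [z], ⟨⟨hzK, hzA⟩, trivial⟩, ⟨q, hz, rfl⟩, by simp⟩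
    | cons y t =>
      obtain ⟨⟨hyK, hyA⟩, halt⟩ := halt
      obtain ⟨p₁, hy, hpath⟩ := hpath
      rcases eq_or_ne i j with rfl | hij
      · have hw := hz.trans hy
        have hwK : z * y ∈ K i := mul_mem hzK hyK
        by_cases hwA : z * y ∈ A
        · cases t with
          | nil => exact .inl (by simpa using hwA)
          | cons y₂ t =>
            obtain ⟨⟨hyK₂, hyA₂⟩, halt⟩ := halt
            obtain ⟨p₂, hy₂, hpath⟩ := hpath
            refine .inr ⟨!i, (z * y * y₂) :: t, ⟨⟨mul_mem (hKA.base_le _ hwA) hyK₂, ?_⟩, halt⟩,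
              ⟨p₂, .trans (.single (.inr ⟨hwA, hw.of_sideEdges⟩)) hy₂, hpath⟩,
              by simp [mul_assoc]⟩
            rwa [A.mul_mem_cancel_left hwA]
        · exact .inr ⟨i, (z * y) :: t, ⟨⟨hwK, hwA⟩, halt⟩, ⟨p₁, hw, hpath⟩, by simp [mul_assoc]⟩
      · by_cases hzA : z ∈ A
        · refine .inr ⟨i, (z * y) :: t, ⟨⟨mul_mem (hKA.base_le _ hzA) hyK, ?_⟩, halt⟩,
            ⟨p₁, .trans (.single (.inr ⟨hzA, hz.of_sideEdges⟩)) hy, hpath⟩, by simp [mul_assoc]⟩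
          rwa [A.mul_mem_cancel_left hzA]
        · obtain rfl : i = !j := by cases i <;> cases j <;> simp_all
          exact .inr ⟨j, z :: y :: t, ⟨⟨hzK, hzA⟩, ⟨hyK, hyA⟩, halt⟩, ⟨q, hz, p₁, hy, hpath⟩,
            by simp⟩

theorem LabelledPath.exists_alternatingPath (hKA : IsAmalgam K A)
    (hE : ∀ p z q, (p, z, q) ∈ E → ∃ i, z ∈ K i) {p q : Q} {x : P}
    (h : LabelledPath E p x q) :
    x ∈ A ∨ ∃ i ys, Alternating K A i ys ∧ AlternatingPath (sideEdges K A E) i p ys q ∧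
      ys.prod = x := by
  induction h with
  | nil => exact .inl A.one_mem
  | cons h hx ih =>
    obtain ⟨i, hi⟩ := hE _ _ _ h
    exact exists_alternatingPath_mul hKA (.single (.inl ⟨hi, h⟩)) hx ih

/-- Every element outside of `A` has a reduced expression. -/
theorem IsAmalgam.exists_alternating (hKA : IsAmalgam K A) (x : P) :
    x ∈ A ∨ ∃ i ys, Alternating K A i ys ∧ ys.prod = x := by
  have hx : LabelledPath {s : Unit × P × Unit | ∃ i, s.2.1 ∈ K i} () x () := by
    have : x ∈ ⨆ i, K i := hKA.iSup_eq_top ▸ Subgroup.mem_top x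
    induction this using Subgroup.iSup_induction' with
    | hp i x hx => exact .single ⟨i, hx⟩
    | h1 => exact .nil ()
    | hmul x y _ _ hx hy => exact hx.trans hy
  exact (hx.exists_alternatingPath hKA fun _ _ _ h => h).imp_right
    fun ⟨i, ys, h, _, h'⟩ => ⟨i, ys, h, h'⟩

theorem Alternating.side_unique (hKA : IsAmalgam K A) {i j : Bool} {ys zs : List P}
    (hys : Alternating K A i ys) (hzs : Alternating K A j zs) (hne : ys ≠ [])
    (h : ys.prod = zs.prod) : i = j := by
  by_contra hij
  obtain rfl : i = !j := by cases i <;> cases j <;> simp_all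
  have hne' : zs ≠ [] := by
    rintro rfl
    exact hKA.prod_notMem _ ys hys hne (by simp [h])
  obtain ⟨k, hk⟩ := hys.hasReducedForm hne
  obtain ⟨l, hl⟩ := hzs.hasReducedForm hne'
  exact (hl.inv.mul hk).ne_one hKA (by simp [h])

theorem AlternatingPath.twistedPath (hKA : IsAmalgam K A) {F : Bool → Set (Q × P × Q)} {i : Bool}
    {p q : Q} {a : P} {ys zs : List P} (hys : Alternating K A i ys) (hzs : Alternating K A i zs)
    (ha : a ∈ A) (hpath : AlternatingPath F i p zs q) (h : a * ys.prod = zs.prod) :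
    TwistedPath A F i p a ys q := by
  induction ys generalizing i p a zs with
  | nil =>
    have hzA : zs.prod ∈ A := by simpa [← h] using ha
    obtain rfl : zs = [] := by
      by_contra hne
      exact hKA.prod_notMem _ zs hzs hne hzA
    exact ⟨hpath, by simpa using h⟩
  | cons y t ih =>
    cases zs with
    | nil =>
      refine absurd ?_ (hKA.prod_notMem _ _ hys (by simp))
      rw [← A.mul_mem_cancel_left ha, h]
      exact A.one_mem
    | cons z t' =>
      obtain ⟨⟨hyK, hyA⟩, halt⟩ := hys
      obtain ⟨⟨hzK, hzA⟩, halt'⟩ := hzs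
      obtain ⟨p', hz, hpath⟩ := hpath
      have hc : z⁻¹ * (a * y) * t.prod = t'.prod := by
        rw [List.prod_cons, List.prod_cons] at h
        rw [mul_assoc, mul_assoc, h, inv_mul_cancel_left]
      have hcA : z⁻¹ * (a * y) ∈ A := by
        by_contra hcA
        have h₁ : HasReducedForm K A i i (z⁻¹ * (a * y)) :=
          .single (mul_mem (inv_mem hzK) (mul_mem (hKA.base_le i ha) hyK)) hcA
        have h₂ : ∃ k, HasReducedForm K A i k t'.prod := by
          rw [← hc]
          rcases eq_or_ne t [] with rfl | hne
          · exact ⟨i, by simpa using h₁⟩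
          · obtain ⟨k, hk⟩ := halt.hasReducedForm hne
            exact ⟨k, h₁.mul hk⟩
        obtain ⟨k, hk⟩ := h₂
        rcases eq_or_ne t' [] with rfl | hne
        · exact hk.ne_one hKA rfl
        · obtain ⟨l, hl⟩ := halt'.hasReducedForm hne
          have hl' := hl.inv
          have : i = !!i := by simp
          rw [this] at hk
          exact (hl'.mul hk).ne_one hKA (by simp)
      refine ⟨p', _, hcA, ?_, ih halt halt' hcA hpath hc⟩
      have : a * y * (z⁻¹ * (a * y))⁻¹ = z := by group
      rwa [this]

/-- Along a reduced expression of `x ∉ A`, all paths labelled `x` are found by `TwistedPath`. -/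
theorem labelledPath_prod_iff_twistedPath (hKA : IsAmalgam K A)
    (hE : ∀ p z q, (p, z, q) ∈ E → ∃ i, z ∈ K i) {i : Bool} {p q : Q} {ys : List P}
    (hys : Alternating K A i ys) (hne : ys.prod ∉ A) :
    LabelledPath E p ys.prod q ↔ TwistedPath A (sideEdges K A E) i p 1 ys q := by
  refine ⟨fun h => ?_, fun h => by simpa using h.labelledPath⟩
  obtain h | ⟨j, zs, hzs, hpath, hprod⟩ := h.exists_alternatingPath hKA hE
  · exact absurd h hne
  · have hne' : ys ≠ [] := by
      rintro rfl
      exact hne A.one_mem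
    obtain rfl := hys.side_unique hKA hzs hne' hprod.symm
    exact hpath.twistedPath hKA hys hzs A.one_mem (by simp [hprod])

theorem finite_sideEdges [Finite Q] (hA : (A : Set P).Finite) (hE : E.Finite) (i : Bool) :
    (sideEdges K A E i).Finite := by
  refine (hE.union (Set.finite_univ.prod (hA.prod (Set.finite_univ (α := Q))))).subset ?_
  rintro ⟨p, z, q⟩ (h | h)
  · exact .inl h.2
  · exact .inr ⟨trivial, h.1, trivial⟩

end GroupTheory

section StateEncoding

variable {P Q : Type*} [Group P] {K : Bool → Subgroup P} {A : Subgroup P}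

/-- The element `u p * γ * (u q)⁻¹` attached to a labelled edge `(p, γ, q)`. -/
def edgeValue (u : Q → P) (s : Q × P × Q) : P := u s.1 * s.2.1 * (u s.2.2)⁻¹

/-- A sequence of labelled edges without trivial loops, in which consecutive edges never match. -/
def NonMatching (l : List (Q × P × Q)) : Prop :=
  (∀ s ∈ l, ¬(s.1 = s.2.2 ∧ s.2.1 = 1)) ∧ l.IsChain fun s t => s.2.2 ≠ t.1

/-- The elements `u p` encode the states `p` faithfully relative to the subgroup `K`. -/
def IsEncoding (K : Subgroup P) (u : Q → P) : Prop :=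
  ∀ l : List (Q × P × Q), l ≠ [] → NonMatching l → (∀ s ∈ l, s.2.1 ∈ K) →
    (l.map (edgeValue u)).prod ≠ 1

theorem NonMatching.cons_cases {R : Q → P → Q → Prop}
    (hR : ∀ {p q r x y}, R p x q → R q y r → R p (x * y) r) (u : Q → P)
    {l : List (Q × P × Q)} (hl : NonMatching l) (hlR : ∀ s ∈ l, R s.1 s.2.1 s.2.2)
    {p q : Q} {z : P} (hz : R p z q) :
    ∃ l', NonMatching l' ∧ (∀ s ∈ l', R s.1 s.2.1 s.2.2) ∧
      (l'.map (edgeValue u)).prod = edgeValue u (p, z, q) * (l.map (edgeValue u)).prod := by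
  by_cases h0 : p = q ∧ z = 1
  · obtain ⟨rfl, rfl⟩ := h0
    exact ⟨l, hl, hlR, by simp [edgeValue]⟩
  cases l with
  | nil => exact ⟨[(p, z, q)], ⟨by simpa using h0, by simp⟩, by simpa using hz, by simp⟩
  | cons s t =>
    obtain ⟨p₁, r, q₁⟩ := s
    have ht : NonMatching t := ⟨fun s hs => hl.1 s (by simp [hs]), hl.2.tail⟩
    by_cases hq : q = p₁
    · subst hq
      have hr : R q r q₁ := hlR (q, r, q₁) (by simp)
      have hval : edgeValue u (p, z * r, q₁) = edgeValue u (p, z, q) * edgeValue u (q, r, q₁) := by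
        simp [edgeValue, mul_assoc]
      by_cases h1 : p = q₁ ∧ z * r = 1
      · refine ⟨t, ht, fun s hs => hlR s (by simp [hs]), ?_⟩
        rw [List.map_cons, List.prod_cons, ← mul_assoc, ← hval]
        simp [edgeValue, h1.1, h1.2]
      · refine ⟨(p, z * r, q₁) :: t, ⟨?_, ?_⟩, ?_, ?_⟩
        · intro s hs
          rcases List.mem_cons.1 hs with rfl | hs
          · exact h1
          · exact hl.1 s (by simp [hs])
        · have := hl.2
          rw [List.isChain_cons] at this ⊢
          exact this
        · intro s hs
          rcases List.mem_cons.1 hs with rfl | hs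
          · exact hR hz hr
          · exact hlR s (by simp [hs])
        · rw [List.map_cons, List.prod_cons, hval, List.map_cons, List.prod_cons, mul_assoc]
    · refine ⟨(p, z, q) :: (p₁, r, q₁) :: t, ⟨?_, ?_⟩, ?_, by simp⟩
      · intro s hs
        rcases List.mem_cons.1 hs with rfl | hs
        · exact h0
        · exact hl.1 s hs
      · exact List.isChain_cons_cons.2 ⟨hq, hl.2⟩
      · intro s hs
        rcases List.mem_cons.1 hs with rfl | hs
        · exact hz
        · exact hlR s hs

theorem exists_nonMatching_of_mem_closure (u : Q → P) {E : Set (Q × P × Q)} {x : P}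
    (hx : x ∈ Submonoid.closure (edgeValue u '' E)) :
    ∃ l, NonMatching l ∧ (∀ s ∈ l, LabelledPath E s.1 s.2.1 s.2.2) ∧
      (l.map (edgeValue u)).prod = x := by
  induction hx using Submonoid.closure_induction_left with
  | one => exact ⟨[], ⟨by simp, by simp⟩, by simp, by simp⟩
  | mul_left x hx y _ ih =>
    obtain ⟨⟨p, z, q⟩, hE, rfl⟩ := hx
    obtain ⟨l, hl, hlE, rfl⟩ := ih
    exact hl.cons_cases LabelledPath.trans u hlE (.single hE)

theorem IsEncoding.labelledPath_iff {K : Subgroup P} {u : Q → P} (hu : IsEncoding K u)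
    {E : Set (Q × P × Q)} (hE : ∀ p z q, (p, z, q) ∈ E → z ∈ K) {p q : Q} {x : P} (hx : x ∈ K) :
    LabelledPath E p x q ↔
      u p * x * (u q)⁻¹ ∈ Submonoid.closure (edgeValue u '' E) := by
  constructor
  · intro h
    clear hx
    induction h with
    | nil => simp
    | @cons p q r z x h _ ih =>
      have := mul_mem (Submonoid.subset_closure (Set.mem_image_of_mem (edgeValue u) h)) ih
      simpa [edgeValue, mul_assoc] using this
  · intro h
    obtain ⟨l, hl, hlE, hprod⟩ := exists_nonMatching_of_mem_closure u h
    have hlK : ∀ s ∈ l, s.2.1 ∈ K := fun s hs => (hlE s hs).mem_subgroup hE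
    have hone : edgeValue u (q, x⁻¹, p) * (l.map (edgeValue u)).prod = 1 := by
      rw [hprod]
      simp [edgeValue, mul_assoc]
    by_cases h0 : q = p ∧ x⁻¹ = 1
    · obtain ⟨rfl, h0⟩ := h0
      rw [inv_eq_one] at h0
      exact h0 ▸ LabelledPath.nil q
    cases l with
    | nil =>
      exact absurd hone (by
        simpa using hu [(q, x⁻¹, p)] (by simp) ⟨by simpa using h0, by simp⟩ (by simpa using hx))
    | cons s t =>
      obtain ⟨p₁, r, q₁⟩ := s
      by_cases hp : p = p₁
      · subst hp
        by_cases h1 : q = q₁ ∧ x⁻¹ * r = 1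
        · obtain ⟨rfl, h1⟩ := h1
          rw [inv_mul_eq_one] at h1
          exact h1 ▸ hlE (p, r, q) (by simp)
        · refine absurd ?_ (hu ((q, x⁻¹ * r, q₁) :: t) (by simp) ⟨?_, ?_⟩ ?_)
          · simpa [edgeValue, mul_assoc] using hone
          · intro s hs
            rcases List.mem_cons.1 hs with rfl | hs
            · exact h1
            · exact hl.1 s (by simp [hs])
          · have := hl.2
            rw [List.isChain_cons] at this ⊢
            exact this
          · intro s hs
            rcases List.mem_cons.1 hs with rfl | hs
            · exact mul_mem (inv_mem hx) (hlK (p, r, q₁) (by simp))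
            · exact hlK s (by simp [hs])
      · refine absurd hone (hu ((q, x⁻¹, p) :: (p₁, r, q₁) :: t) (by simp) ⟨?_, ?_⟩ ?_)
        · intro s hs
          rcases List.mem_cons.1 hs with rfl | hs
          · exact h0
          · exact hl.1 s hs
        · exact List.isChain_cons_cons.2 ⟨hp, hl.2⟩
        · intro s hs
          rcases List.mem_cons.1 hs with rfl | hs
          · exact inv_mem hx
          · exact hlK s hs

/-- Infinitely many elements of an infinite subgroup which are pairwise incongruent modulo a
finite subgroup, on both sides. -/
theorem exists_separated_family [Finite Q] {K A : Subgroup P} (hK : (K : Set P).Infinite)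
    (hA : (A : Set P).Finite) : ∃ x : Q → P, (∀ p, x p ∈ K ∧ x p ∉ A) ∧
      ∀ p q, p ≠ q → x p * (x q)⁻¹ ∉ A ∧ (x p)⁻¹ * x q ∉ A := by
  classical
  have hsymm : Std.Symm fun x y : P => x * y⁻¹ ∉ A ∧ x⁻¹ * y ∉ A := by
    constructor
    rintro x y ⟨h₁, h₂⟩
    exact ⟨by rwa [← inv_mem_iff, mul_inv_rev, inv_inv],
      by rwa [← inv_mem_iff, mul_inv_rev, inv_inv]⟩
  obtain ⟨f, hf, hsep⟩ := exists_seq_of_forall_finset_exists' (fun x : P => x ∈ K ∧ x ∉ A)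
    (fun x y : P => x * y⁻¹ ∉ A ∧ x⁻¹ * y ∉ A) fun s _ => by
      have hfin : ((A : Set P) ∪ ⋃ x ∈ s, ((fun a => a⁻¹ * x) '' A ∪ (fun a => x * a) '' A)).Finite :=
        hA.union (s.finite_toSet.biUnion fun x _ => (hA.image _).union (hA.image _))
      obtain ⟨y, hyK, hy⟩ := hK.exists_notMem_finite hfin
      simp only [Set.mem_union, SetLike.mem_coe, Set.mem_iUnion, not_or, not_exists] at hy
      refine ⟨y, ⟨hyK, hy.1⟩, fun x hx => ⟨fun h => (hy.2 x hx).1 ⟨_, h, by group⟩,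
        fun h => (hy.2 x hx).2 ⟨_, h, by group⟩⟩⟩
  obtain ⟨n, ⟨e⟩⟩ := Finite.exists_equiv_fin Q
  exact ⟨fun p => f (e p), fun p => hf _, fun p q hpq => hsep fun h =>
    hpq (e.injective (Fin.ext h))⟩

theorem IsAmalgam.exists_isEncoding [Finite Q] (hKA : IsAmalgam K A) (hA : (A : Set P).Finite)
    {i : Bool} (hK : (K i : Set P).Infinite) {h : P} (hhK : h ∈ K (!i)) (hhA : h ∉ A)
    (hh : ∀ a ∈ A, h⁻¹ * a * h ∈ A → a = 1) : ∃ u : Q → P, IsEncoding (K i) u := by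
  obtain ⟨x, hx, hsep⟩ := exists_separated_family (Q := Q) hK hA
  refine ⟨fun p => x p * h * x p * h⁻¹, fun l hne hl hlK => ?_⟩
  have hred : HasReducedForm K A (!i) (!i) h := .single hhK hhA
  have hsingle : ∀ {y}, y ∈ K i → y ∉ A → HasReducedForm K A (!!i) i y := fun hy hyA => by
    simpa using HasReducedForm.single hy hyA
  have hcore : ∀ p z q, z ∈ K i → ¬(p = q ∧ z = 1) →
      HasReducedForm K A (!i) (!i) (h * (x p * (h⁻¹ * z * h) * (x q)⁻¹) * h⁻¹) := by
    intro p z q hz hpq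
    refine (hred.mul (k := i) ?_).mul (by simpa using hred.inv)
    by_cases hz1 : z = 1
    · subst hz1
      have := hsep p q (by simpa using hpq)
      simpa using hsingle (mul_mem (hx p).1 (inv_mem (hx q).1)) this.1
    · have hconj : HasReducedForm K A (!i) (!i) (h⁻¹ * z * h) := by
        by_cases hzA : z ∈ A
        · exact .single (mul_mem (mul_mem (inv_mem hhK) (hKA.base_le _ hzA)) hhK)
            fun h' => hz1 (hh z hzA h')
        · exact (hred.inv.mul (hsingle hz hzA)).mul hred
      refine ((hsingle (hx p).1 (hx p).2).mul hconj).mul ?_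
      exact hsingle (inv_mem (hx q).1) (by simpa using (hx q).2)
  have key : ∀ (l : List (Q × P × Q)) (s : Q × P × Q), NonMatching (s :: l) →
      (∀ t ∈ s :: l, t.2.1 ∈ K i) → ∃ q c, HasReducedForm K A (!i) (!i) c ∧
        ((s :: l).map (edgeValue fun p => x p * h * x p * h⁻¹)).prod = x s.1 * c * (x q)⁻¹ := by
    intro l
    induction l with
    | nil =>
      rintro ⟨p, z, q⟩ hl hlK
      refine ⟨q, _, hcore p z q (hlK (p, z, q) (by simp)) (hl.1 (p, z, q) (by simp)), ?_⟩
      simp [edgeValue, mul_assoc]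
    | cons t l ih =>
      rintro ⟨p, z, q⟩ hl hlK
      obtain ⟨q', c, hc, hprod⟩ := ih t ⟨fun s hs => hl.1 s (by simp [hs]), hl.2.tail⟩
        fun s hs => hlK s (by simp [hs])
      have hqt : q ≠ t.1 := (List.isChain_cons_cons.1 hl.2).1
      have hgap := hsingle (mul_mem (inv_mem (hx q).1) (hx t.1).1) (hsep _ _ hqt).2
      refine ⟨q', _, ((hcore p z q (hlK (p, z, q) (by simp)) (hl.1 (p, z, q) (by simp))).mul
        hgap).mul hc, ?_⟩
      rw [List.map_cons, List.prod_cons, hprod]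
      simp [edgeValue, mul_assoc]
  cases l with
  | nil => exact absurd rfl hne
  | cons s l =>
    obtain ⟨q, c, hc, hprod⟩ := key l s hl hlK
    rw [hprod]
    have h1 := (HasReducedForm.single (K := K) (hx s.1).1 (hx s.1).2).mul hc
    exact (h1.mul (hsingle (inv_mem (hx q).1) (by simpa using (hx q).2))).ne_one hKA

end StateEncoding

section Decidability

theorem map_ofList_flatten {P Δ : Type*} [Group P] (e : FreeMonoid Δ →* P)
    (ys : List (List Δ)) :
    e (FreeMonoid.ofList ys.flatten) = (ys.map fun y => e (FreeMonoid.ofList y)).prod := by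
  induction ys with
  | nil => simp
  | cons y ys ih =>
    rw [List.flatten_cons, FreeMonoid.ofList_append, map_mul, ih, List.map_cons, List.prod_cons]

variable {P Δ : Type*} [Group P] [Primcodable Δ]

/-- Membership in `S` of the group element represented by a word is decidable. -/
def DecidableIn (e : FreeMonoid Δ →* P) (S : Set P) : Prop :=
  ComputablePred fun w : List Δ => e (FreeMonoid.ofList w) ∈ S

variable {e : FreeMonoid Δ →* P}

theorem DecidableIn.translate (he : Function.Surjective e) {S : Set P} (hS : DecidableIn e S)
    (a b : P) : DecidableIn e {x | a * x * b ∈ S} := by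
  obtain ⟨v, rfl⟩ := he a
  obtain ⟨w, rfl⟩ := he b
  have : Computable fun u : List Δ => FreeMonoid.toList v ++ u ++ FreeMonoid.toList w :=
    Computable.list_append.comp (Computable.list_append.comp (Computable.const _) Computable.id)
      (Computable.const _)
  exact (ComputablePred.comp hS this).of_eq fun u => by
    simp [FreeMonoid.ofList_append, mul_assoc]

theorem DecidableIn.of_finite (he : Function.Surjective e) (h1 : DecidableIn e {1}) {S : Set P}
    (hS : S.Finite) : DecidableIn e S := by
  refine (ComputablePred.exists_mem_finset hS.toFinset
    fun x _ => h1.translate he x⁻¹ 1).of_eq fun w => ?_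
  simp [inv_mul_eq_one]

theorem computable_word_inv [Finite Δ] (he : Function.Surjective e) :
    ∃ f : List Δ → List Δ, Computable f ∧
      ∀ w, e (FreeMonoid.ofList (f w)) = (e (FreeMonoid.ofList w))⁻¹ := by
  choose bar hbar using fun d : Δ => he (e (FreeMonoid.of d))⁻¹
  refine ⟨fun w => w.reverse.flatMap fun d => FreeMonoid.toList (bar d),
    (Primrec.list_flatMap Primrec.list_reverse
      ((Primrec.dom_finite fun d => FreeMonoid.toList (bar d)).comp Primrec.snd).to₂).to_comp,
    fun w => ?_⟩
  beta_reduce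
  induction w with
  | nil => simp
  | cons d w ih =>
    rw [List.reverse_cons, List.flatMap_append, FreeMonoid.ofList_append, map_mul, ih,
      FreeMonoid.ofList_cons, map_mul, mul_inv_rev]
    simp [hbar]

theorem DecidableIn.eq_prod [Finite Δ] (he : Function.Surjective e) (h1 : DecidableIn e {1}) :
    ComputablePred fun x : List Δ × List (List Δ) =>
      (x.2.map fun y => e (FreeMonoid.ofList y)).prod = e (FreeMonoid.ofList x.1) := by
  obtain ⟨f, hf, hinv⟩ := computable_word_inv he
  have : Computable fun x : List Δ × List (List Δ) => x.2.flatten ++ f x.1 :=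
    Computable.list_append.comp (Primrec.list_flatten.to_comp.comp Computable.snd)
      (hf.comp Computable.fst)
  refine (ComputablePred.comp h1 this).of_eq fun x => ?_
  rw [Set.mem_singleton_iff, FreeMonoid.ofList_append, map_mul, hinv, map_ofList_flatten,
    mul_inv_eq_one]

variable {K : Bool → Subgroup P} {A : Subgroup P}

theorem computablePred_alternating (hK : ∀ i, DecidableIn e (K i)) (hA : DecidableIn e A)
    (i : Bool) : ComputablePred fun ys : List (List Δ) =>
      Alternating K A i (ys.map fun y => e (FreeMonoid.ofList y)) := by
  let f : List Δ → Set Bool → Set Bool := fun y t =>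
    {j | (e (FreeMonoid.ofList y) ∈ K j ∧ e (FreeMonoid.ofList y) ∉ A) ∧ (!j) ∈ t}
  have hf : ∀ t t', ComputablePred fun y => f y t = t' := fun t t' => by
    refine (ComputablePred.forall_finite fun j =>
      (((hK j).and' hA.not).and' (.const ((!j) ∈ t))).iff_const (j ∈ t')).of_eq fun y => ?_
    simp only [f, Set.ext_iff, Set.mem_ofPred_eq, SetLike.mem_coe]
  have key : ∀ ys : List (List Δ), ∀ j, j ∈ ys.foldr f Set.univ ↔
      Alternating K A j (ys.map fun y => e (FreeMonoid.ofList y)) := fun ys => by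
    induction ys with
    | nil => simp [Alternating]
    | cons y ys ih =>
      intro j
      rw [List.foldr_cons, List.map_cons, Alternating, ← ih]
      rfl
  refine (ComputablePred.exists_finite fun t : Set Bool =>
    (ComputablePred.list_foldr hf Set.univ t).and' (.const (i ∈ t))).of_eq fun ys => ?_
  exact ⟨fun ⟨_, ht, h⟩ => (key ys i).1 (ht ▸ h), fun h => ⟨_, rfl, (key ys i).2 h⟩⟩

theorem computablePred_twistedPath {Q : Type*} [Finite Q] (he : Function.Surjective e)
    (hA : (A : Set P).Finite) {F : Bool → Set (Q × P × Q)}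
    (hF : ∀ i p q, DecidableIn e {x | LabelledPath (F i) p x q}) (i : Bool) (p q : Q) :
    ComputablePred fun ys : List (List Δ) =>
      TwistedPath A F i p 1 (ys.map fun y => e (FreeMonoid.ofList y)) q := by
  have : Finite A := hA
  let f : List Δ → Set (Bool × Q × A) → Set (Bool × Q × A) := fun y t =>
    {s | ∃ p', ∃ b : A, LabelledPath (F s.1) s.2.1 (s.2.2 * e (FreeMonoid.ofList y) * (b : P)⁻¹) p' ∧
      (!s.1, p', b) ∈ t}
  have hf : ∀ t t', ComputablePred fun y => f y t = t' := fun t t' => by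
    refine (ComputablePred.forall_finite fun s : Bool × Q × A =>
      ComputablePred.iff_const (ComputablePred.exists_finite fun p' =>
        ComputablePred.exists_finite fun b : A =>
          ((hF s.1 s.2.1 p').translate he s.2.2 (b : P)⁻¹).and' (.const ((!s.1, p', b) ∈ t)))
        (s ∈ t')).of_eq fun y => ?_
    simp only [f, Set.ext_iff, Set.mem_ofPred_eq]
  have key : ∀ ys : List (List Δ), ∀ j p (a : A),
      (j, p, a) ∈ ys.foldr f {s | s.2.1 = q ∧ (s.2.2 : P) = 1} ↔
      TwistedPath A F j p a (ys.map fun y => e (FreeMonoid.ofList y)) q := fun ys => by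
    induction ys with
    | nil => simp [TwistedPath]
    | cons y ys ih =>
      intro j p a
      simp only [List.foldr_cons, List.map_cons, TwistedPath]
      constructor
      · rintro ⟨p', b, h, h'⟩
        exact ⟨p', b, b.2, h, (ih _ _ _).1 h'⟩
      · rintro ⟨p', b, hb, h, h'⟩
        exact ⟨p', ⟨b, hb⟩, h, (ih _ _ ⟨b, hb⟩).2 h'⟩
  refine (ComputablePred.exists_finite fun t : Set (Bool × Q × A) =>
    (ComputablePred.list_foldr hf {s | s.2.1 = q ∧ (s.2.2 : P) = 1} t).and'
      (.const ((i, p, (1 : A)) ∈ t))).of_eq fun ys => ?_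
  exact ⟨fun ⟨_, ht, h⟩ => (key ys i p 1).1 (ht ▸ h), fun h => ⟨_, rfl, (key ys i p 1).2 h⟩⟩

/-- Decidability of path labels in both factors yields decidability in the amalgam. -/
theorem decidableIn_labelledPath_of_sides {Q : Type*} [Finite Q] [Finite Δ]
    (hKA : IsAmalgam K A) (he : Function.Surjective e) (hA : (A : Set P).Finite)
    (h1 : DecidableIn e {1}) (hK : ∀ i, DecidableIn e (K i)) {E : Set (Q × P × Q)}
    (hE : ∀ p z q, (p, z, q) ∈ E → ∃ i, z ∈ K i)
    (hside : ∀ i p q, DecidableIn e {x | LabelledPath (sideEdges K A E i) p x q}) (p q : Q) :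
    DecidableIn e {x | LabelledPath E p x q} := by
  have hAd : DecidableIn e A := .of_finite he h1 hA
  have hAE : DecidableIn e {x | x ∈ A ∧ LabelledPath E p x q} :=
    .of_finite he h1 (hA.subset fun x hx => hx.1)
  let v : List (List Δ) → List P := fun ys => ys.map fun y => e (FreeMonoid.ofList y)
  refine ComputablePred.of_certificate (β := List (List Δ))
    (C := fun w ys => e (FreeMonoid.ofList w) ∈ A ∨
      (∃ i, Alternating K A i (v ys)) ∧ (v ys).prod = e (FreeMonoid.ofList w))
    (D := fun w ys => (e (FreeMonoid.ofList w) ∈ A ∧ LabelledPath E p (e (FreeMonoid.ofList w)) q) ∨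
      (e (FreeMonoid.ofList w) ∉ A ∧ ∃ i, Alternating K A i (v ys) ∧
        TwistedPath A (sideEdges K A E) i p 1 (v ys) q)) ?_ ?_ ?_ ?_
  · exact (hAd.comp Computable.fst).or' <| (ComputablePred.exists_finite fun i =>
      (computablePred_alternating hK hAd i).comp Computable.snd).and' (h1.eq_prod he)
  · exact (ComputablePred.comp hAE Computable.fst).or' <| (hAd.comp Computable.fst).not.and' <|
      ComputablePred.exists_finite fun i =>
        ((computablePred_alternating hK hAd i).comp Computable.snd).and'
          ((computablePred_twistedPath he hA hside i p q).comp Computable.snd)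
  · intro w
    rcases hKA.exists_alternating (e (FreeMonoid.ofList w)) with h | ⟨i, ys, hys, hprod⟩
    · exact ⟨[], .inl h⟩
    · choose g hg using he
      refine ⟨ys.map fun y => FreeMonoid.toList (g y), .inr ?_⟩
      have : v (ys.map fun y => FreeMonoid.toList (g y)) = ys := by
        simp [v, Function.comp_def, hg]
      exact ⟨⟨i, by rwa [this]⟩, by rwa [this]⟩
  · intro w ys hC
    simp only [Set.mem_ofPred_eq]
    by_cases hw : e (FreeMonoid.ofList w) ∈ A
    · simp [hw]
    · obtain ⟨⟨i, hi⟩, hprod⟩ := hC.resolve_left hw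
      simp only [hw, false_and, not_false_eq_true, true_and, false_or]
      rw [← hprod] at hw ⊢
      constructor
      · exact fun h => ⟨i, hi, (labelledPath_prod_iff_twistedPath hKA hE hi hw).1 h⟩
      · rintro ⟨j, hj, h⟩
        exact (labelledPath_prod_iff_twistedPath hKA hE hj hw).2 h

/-- If membership in finitely generated submonoids of the amalgam is decidable, then so is the
set of labels of paths between two vertices of a finite graph labelled in one factor. -/
theorem decidableIn_labelledPath_side {Q : Type*} [Finite Q] (hKA : IsAmalgam K A)
    (he : Function.Surjective e) (hA : (A : Set P).Finite)
    (hM : ∀ T : Set P, T.Finite → DecidableIn e (Submonoid.closure T))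
    (h1 : DecidableIn e {1}) {i : Bool} (hK : DecidableIn e (K i))
    (hconj : ∃ h ∈ K (!i), h ∉ A ∧ ∀ a ∈ A, h⁻¹ * a * h ∈ A → a = 1)
    {E : Set (Q × P × Q)} (hEfin : E.Finite) (hE : ∀ p z q, (p, z, q) ∈ E → z ∈ K i) (p q : Q) :
    DecidableIn e {x | LabelledPath E p x q} := by
  rcases (K i : Set P).finite_or_infinite with hfin | hinf
  · exact .of_finite he h1 (hfin.subset fun x hx => hx.mem_subgroup hE)
  · obtain ⟨h, hhK, hhA, hh⟩ := hconj
    obtain ⟨u, hu⟩ := hKA.exists_isEncoding (Q := Q) hA hinf hhK hhA hh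
    refine (hK.and' ((hM _ (hEfin.image (edgeValue u))).translate he (u p) (u q)⁻¹)).of_eq
      fun w => ⟨fun h => (hu.labelledPath_iff hE h.1).2 h.2, fun h => ?_⟩
    have hx := LabelledPath.mem_subgroup h hE
    exact ⟨hx, (hu.labelledPath_iff hE hx).1 h⟩

theorem decidableIn_labelledPath {Q : Type*} [Finite Q] [Finite Δ] (hKA : IsAmalgam K A)
    (he : Function.Surjective e) (hA : (A : Set P).Finite)
    (hM : ∀ T : Set P, T.Finite → DecidableIn e (Submonoid.closure T))
    (hfg : ∀ i, (K i).FG)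
    (hconj : ∀ i, ∃ h ∈ K i, h ∉ A ∧ ∀ a ∈ A, h⁻¹ * a * h ∈ A → a = 1)
    {E : Set (Q × P × Q)} (hEfin : E.Finite) (hE : ∀ p z q, (p, z, q) ∈ E → ∃ i, z ∈ K i)
    (p q : Q) : DecidableIn e {x | LabelledPath E p x q} := by
  have h1 : DecidableIn e {1} := by
    simpa [Submonoid.closure_empty] using hM ∅ Set.finite_empty
  have hK : ∀ i, DecidableIn e (K i) := fun i => by
    obtain ⟨T, hT⟩ := (Subgroup.fg_iff_submonoid_fg _).1 (hfg i)
    have := hM T T.finite_toSet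
    rwa [hT] at this
  refine decidableIn_labelledPath_of_sides hKA he hA h1 hK hE (fun i p q => ?_) p q
  exact decidableIn_labelledPath_side hKA he hA hM h1 (hK i) (hconj (!i))
    (finite_sideEdges hA hEfin i)
    (fun _ _ _ h => LabelledPath.mem_of_sideEdges hKA (.single h)) p q

end Decidability

section Automata

open Computability

/-- The Kleene star of a finite set of words is regular. -/
theorem Language.IsRegular.kstar_of_finite {α : Type} {L : Language α}
    (hL : Set.Finite (L : Set (List α))) : (L∗).IsRegular := by
  let S : Set (List α) := {l | l = [] ∨ ∃ w ∈ L, l <:+ w}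
  have hS : S.Finite := by
    classical
    refine ((Set.finite_singleton []).union
      (hL.biUnion fun w _ => w.tails.toFinset.finite_toSet)).subset ?_
    rintro l (rfl | ⟨w, hw, h⟩)
    · exact .inl rfl
    · exact .inr (Set.mem_biUnion hw (by simpa using h))
  let prepend : Set (List α) → Language α := fun T => {y | ∃ l ∈ T, ∃ k ∈ L∗, y = l ++ k}
  have key : ∀ x, ∃ T ⊆ S, L∗.leftQuotient x = prepend T := fun x => by
    induction x using List.reverseRecOn with
    | nil =>
      refine ⟨{[]}, by simp [S], Set.ext fun y => ⟨fun h => ⟨[], rfl, y, h, rfl⟩, ?_⟩⟩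
      rintro ⟨_, rfl, k, hk, rfl⟩
      exact hk
    | append_singleton x d ih =>
      obtain ⟨T, hT, hx⟩ := ih
      refine ⟨{l | d :: l ∈ T ∨ [] ∈ T ∧ d :: l ∈ L}, ?_, ?_⟩
      · rintro l (h | ⟨-, h⟩)
        · obtain h | ⟨w, hw, h⟩ := hT h
          · cases h
          · exact .inr ⟨w, hw, (List.suffix_cons d l).trans h⟩
        · exact .inr ⟨_, h, List.suffix_cons d l⟩
      · rw [Language.leftQuotient_append, hx]
        refine Set.ext fun y => ⟨?_, ?_⟩
        · rintro ⟨l, hl, k, hk, h⟩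
          rcases l with - | ⟨c, l⟩
          · obtain ⟨ws, rfl, hws⟩ := Language.mem_kstar_iff_exists_nonempty.1 hk
            rcases ws with - | ⟨w, ws⟩
            · cases h
            · obtain ⟨hw, hne⟩ := hws w List.mem_cons_self
              obtain ⟨c, l, rfl⟩ := List.exists_cons_of_ne_nil hne
              obtain ⟨rfl, rfl⟩ : d = c ∧ y = l ++ ws.flatten := by simpa using h
              exact ⟨l, .inr ⟨hl, hw⟩, _, Language.join_mem_kstar fun v hv =>
                (hws v (List.mem_cons_of_mem _ hv)).1, rfl⟩
          · obtain ⟨rfl, rfl⟩ : d = c ∧ y = l ++ k := by simpa using h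
            exact ⟨l, .inl hl, k, hk, rfl⟩
        · rintro ⟨l, h | ⟨hT', h⟩, k, hk, rfl⟩
          · exact ⟨_, h, k, hk, rfl⟩
          · obtain ⟨ws, rfl, hws⟩ := Language.mem_kstar.1 hk
            refine ⟨[], hT', (d :: l) ++ ws.flatten, ?_, rfl⟩
            exact Language.mem_kstar.2 ⟨(d :: l) :: ws, rfl, by simpa [h] using hws⟩
  refine .of_finite_range_leftQuotient ((hS.finite_subsets.image prepend).subset ?_)
  rintro _ ⟨x, rfl⟩
  obtain ⟨T, hT, hx⟩ := key x
  exact ⟨T, hT, hx.symm⟩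

theorem image_kstar_eq_closure {P Δ : Type*} [Group P] (e : FreeMonoid Δ →* P) (L : Language Δ) :
    (fun v : List Δ => e (FreeMonoid.ofList v)) '' (L∗ : Language Δ) =
      Submonoid.closure ((fun v : List Δ => e (FreeMonoid.ofList v)) '' L) := by
  refine Set.Subset.antisymm ?_ fun x hx => ?_
  · rintro _ ⟨_, ⟨ws, rfl, hws⟩, rfl⟩
    beta_reduce
    rw [map_ofList_flatten]
    refine Submonoid.list_prod_mem _ fun x hx => ?_
    obtain ⟨w, hw, rfl⟩ := List.mem_map.1 hx
    exact Submonoid.subset_closure ⟨w, hws w hw, rfl⟩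
  · obtain ⟨xs, hxs, rfl⟩ := Submonoid.exists_list_of_mem_closure hx
    choose! f hf using hxs
    refine ⟨(xs.map f).flatten, Language.join_mem_kstar fun w hw => ?_, ?_⟩
    · obtain ⟨x, hx, rfl⟩ := List.mem_map.1 hw
      exact (hf x hx).1
    · beta_reduce
      rw [map_ofList_flatten, List.map_map]
      exact congrArg List.prod ((List.map_congr_left fun x hx => (hf x hx).2).trans xs.map_id)

variable {P Δ σ : Type*} [Group P] {ℓ : Δ → List P}

/-- The suffixes of the words `ℓ d`, together with the empty word. -/
def WordSuffix (ℓ : Δ → List P) : Type _ := {l : List P // l = [] ∨ ∃ d, l <:+ ℓ d}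

instance [Finite Δ] : Finite (WordSuffix ℓ) := by
  refine Set.Finite.to_subtype (s := {l : List P | l = [] ∨ ∃ d, l <:+ ℓ d}) ?_
  classical
  refine ((Set.finite_singleton []).union
    (Set.finite_iUnion fun d => (ℓ d).tails.toFinset.finite_toSet)).subset ?_
  rintro l (rfl | ⟨d, h⟩)
  · exact .inl rfl
  · exact .inr (Set.mem_iUnion.2 ⟨d, by simpa using h⟩)

/-- The automaton `M` with each edge labelled by the letter `d` subdivided into a path labelled by
the word `ℓ d`. -/
def DFA.subdividedEdges (M : DFA Δ σ) (ℓ : Δ → List P) :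
    Set ((σ × WordSuffix ℓ) × P × (σ × WordSuffix ℓ)) :=
  {s | (s.1.2.1 = s.2.1 :: s.2.2.2.1 ∧ s.1.1 = s.2.2.1) ∨
    (s.1.2.1 = [] ∧ s.2.1 = 1 ∧ ∃ d, s.2.2.1 = M.step s.1.1 d ∧ s.2.2.2.1 = ℓ d)}

theorem DFA.finite_subdividedEdges [Finite Δ] [Finite σ] (M : DFA Δ σ) :
    (M.subdividedEdges ℓ).Finite := by
  refine (Set.finite_range fun t : (σ × WordSuffix ℓ) × (σ × WordSuffix ℓ) =>
    (t.1, t.1.2.1.headD 1, t.2)).subset ?_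
  rintro ⟨⟨s, l, hl⟩, z, s', l', hl'⟩ (⟨h, hs⟩ | ⟨h, hz, -⟩)
  · obtain rfl : s = s' := hs
    obtain rfl : l = z :: l' := h
    exact ⟨((s, ⟨_, hl⟩), (s, ⟨_, hl'⟩)), rfl⟩
  · obtain rfl : l = [] := h
    obtain rfl : z = 1 := hz
    exact ⟨((s, ⟨_, hl⟩), (s', ⟨_, hl'⟩)), rfl⟩

theorem DFA.mem_of_subdividedEdges {M : DFA Δ σ} {R : P → Prop} (hone : R 1)
    (hR : ∀ d, ∀ z ∈ ℓ d, R z) {p q : σ × WordSuffix ℓ} {z : P}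
    (h : (p, z, q) ∈ M.subdividedEdges ℓ) : R z := by
  obtain ⟨s, l, hl⟩ := p
  obtain ⟨h, -⟩ | ⟨-, h, -⟩ := h
  · obtain rfl : l = z :: q.2.1 := h
    obtain h | ⟨d, h⟩ := hl
    · cases h
    · exact hR d z (h.subset List.mem_cons_self)
  · obtain rfl : z = 1 := h
    exact hone

theorem DFA.labelledPath_subdividedEdges_iff (M : DFA Δ σ) {e : FreeMonoid Δ →* P}
    (hℓ : ∀ d, e (FreeMonoid.of d) = (ℓ d).prod) (s s' : σ) (x : P) :
    LabelledPath (M.subdividedEdges ℓ) (s, ⟨[], .inl rfl⟩) x (s', ⟨[], .inl rfl⟩) ↔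
      ∃ w : List Δ, e (FreeMonoid.ofList w) = x ∧ M.evalFrom s w = s' := by
  constructor
  · suffices ∀ p q : σ × WordSuffix ℓ, LabelledPath (M.subdividedEdges ℓ) p x q → q.2.1 = [] →
        ∃ w : List Δ, p.2.1.prod * e (FreeMonoid.ofList w) = x ∧ M.evalFrom p.1 w = q.1 from
      fun h => by simpa using this _ _ h rfl
    intro p q h hq
    induction h with
    | nil p => exact ⟨[], by simp [hq], rfl⟩
    | @cons p r q z x h _ ih =>
      obtain ⟨w, rfl, hw⟩ := ih hq
      obtain ⟨h, h'⟩ | ⟨h, rfl, d, hs, hl⟩ := h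
      · dsimp only at h h'
        exact ⟨w, by rw [h, List.prod_cons, mul_assoc], by rw [h', hw]⟩
      · dsimp only at h hs hl
        refine ⟨d :: w, ?_, ?_⟩
        · rw [h, hl, FreeMonoid.ofList_cons, map_mul, hℓ, List.prod_nil]
        · rw [← hw, hs]; rfl
  · rintro ⟨w, rfl, rfl⟩
    have spell : ∀ (l : List P) (hl : l = [] ∨ ∃ d, l <:+ ℓ d) (s : σ),
        LabelledPath (M.subdividedEdges ℓ) (s, ⟨l, hl⟩) l.prod (s, ⟨[], .inl rfl⟩) := by
      intro l hl s
      induction l with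
      | nil => exact .nil _
      | cons z l ih =>
        have hl' : l = [] ∨ ∃ d, l <:+ ℓ d := by
          obtain h | ⟨d, h⟩ := hl
          · cases h
          · exact .inr ⟨d, (List.suffix_cons z l).trans h⟩
        rw [List.prod_cons]
        exact .cons (q := (s, ⟨l, hl'⟩)) (.inl ⟨rfl, rfl⟩) (ih hl')
    induction w generalizing s with
    | nil => simpa using LabelledPath.nil _
    | cons d w ih =>
      rw [FreeMonoid.ofList_cons, map_mul, hℓ]
      refine .trans ?_ (ih (M.step s d))
      simpa using LabelledPath.cons (.inr ⟨rfl, rfl, d, rfl, rfl⟩)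
        (spell (ℓ d) (.inr ⟨d, List.suffix_rfl⟩) (M.step s d))

end Automata

namespace AmalgamatedProduct

open Monoid

universe u v w

variable {A : Type w} {G : Type u} {H : Type v} [Group A] [Group G] [Group H]

/-- The canonical homomorphism `H →* G ∗_A H`. -/
def inr (ι₁ : A →* G) (ι₂ : A →* H) : H →* AmalgamatedProduct ι₁ ι₂ :=
  (QuotientGroup.mk' (Subgroup.normalClosure (AmalgRels ι₁ ι₂))).comp Coprod.inr

theorem inl_apply_eq_inr_apply (ι₁ : A →* G) (ι₂ : A →* H) (a : A) :
    inl ι₁ ι₂ (ι₁ a) = inr ι₁ ι₂ (ι₂ a) := by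
  rw [← mul_inv_eq_one, ← map_inv]
  change QuotientGroup.mk' _ (Coprod.inl (ι₁ a) * Coprod.inr (ι₂ a)⁻¹) = 1
  rw [map_inv, QuotientGroup.mk'_apply, QuotientGroup.eq_one_iff]
  exact Subgroup.subset_normalClosure ⟨a, rfl⟩

/-- The two factors of the amalgamated product, in a common universe. -/
def Factor (G : Type u) (H : Type v) : Bool → Type (max u v)
  | true => ULift.{v} G
  | false => ULift.{u} H

instance : ∀ i, Group (Factor G H i)
  | true => inferInstanceAs (Group (ULift.{v} G))
  | false => inferInstanceAs (Group (ULift.{u} H))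

/-- The homomorphism from the amalgamated subgroup to a factor. -/
def toFactor (ι₁ : A →* G) (ι₂ : A →* H) : ∀ i, A →* Factor G H i
  | true => (MulEquiv.ulift.{u, v} (α := G)).symm.toMonoidHom.comp ι₁
  | false => (MulEquiv.ulift.{v, u} (α := H)).symm.toMonoidHom.comp ι₂

/-- The homomorphism from a factor to the amalgamated product. -/
def ofFactor (ι₁ : A →* G) (ι₂ : A →* H) : ∀ i, Factor G H i →* AmalgamatedProduct ι₁ ι₂
  | true => (inl ι₁ ι₂).comp (MulEquiv.ulift.{u, v} (α := G)).toMonoidHom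
  | false => (inr ι₁ ι₂).comp (MulEquiv.ulift.{v, u} (α := H)).toMonoidHom

/-- The comparison homomorphism to Mathlib's pushout of groups. -/
def toPushout (ι₁ : A →* G) (ι₂ : A →* H) :
    AmalgamatedProduct ι₁ ι₂ →* PushoutI (toFactor ι₁ ι₂) :=
  QuotientGroup.lift _
    (Coprod.lift
      ((PushoutI.of (φ := toFactor ι₁ ι₂) true).comp
        (MulEquiv.ulift.{u, v} (α := G)).symm.toMonoidHom)
      ((PushoutI.of (φ := toFactor ι₁ ι₂) false).comp
        (MulEquiv.ulift.{v, u} (α := H)).symm.toMonoidHom)) <| by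
    refine Subgroup.normalClosure_le_normal ?_
    rintro _ ⟨a, rfl⟩
    rw [SetLike.mem_coe, MonoidHom.mem_ker, map_mul, map_inv, Coprod.lift_apply_inl,
      Coprod.lift_apply_inr, mul_inv_eq_one]
    exact (PushoutI.of_apply_eq_base (toFactor ι₁ ι₂) true a).trans
      (PushoutI.of_apply_eq_base (toFactor ι₁ ι₂) false a).symm

variable {ι₁ : A →* G} {ι₂ : A →* H}

theorem toPushout_ofFactor : ∀ i (x : Factor G H i),
    toPushout ι₁ ι₂ (ofFactor ι₁ ι₂ i x) = PushoutI.of (φ := toFactor ι₁ ι₂) i x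
  | true, _ => rfl
  | false, _ => rfl

theorem ofFactor_toFactor (a : A) : ∀ i,
    ofFactor ι₁ ι₂ i (toFactor ι₁ ι₂ i a) = inl ι₁ ι₂ (ι₁ a)
  | true => rfl
  | false => (inl_apply_eq_inr_apply ι₁ ι₂ a).symm

theorem toFactor_injective (hinj₁ : Function.Injective ι₁) (hinj₂ : Function.Injective ι₂) :
    ∀ i, Function.Injective (toFactor ι₁ ι₂ i)
  | true => (MulEquiv.ulift (α := G)).symm.injective.comp hinj₁
  | false => (MulEquiv.ulift (α := H)).symm.injective.comp hinj₂

theorem ofFactor_mem_base_iff (hφ : ∀ i, Function.Injective (toFactor ι₁ ι₂ i)) {i : Bool}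
    {x : Factor G H i} :
    ofFactor ι₁ ι₂ i x ∈ ((inl ι₁ ι₂).comp ι₁).range ↔ x ∈ (toFactor ι₁ ι₂ i).range := by
  constructor
  · rintro ⟨a, ha⟩
    refine ⟨a, PushoutI.of_injective hφ i ?_⟩
    rw [← toPushout_ofFactor, ← toPushout_ofFactor, ofFactor_toFactor, ← ha]
    rfl
  · rintro ⟨a, rfl⟩
    exact ⟨a, (ofFactor_toFactor a i).symm⟩

theorem exists_reduced_word {i : Bool} {ys : List (AmalgamatedProduct ι₁ ι₂)}
    (hys : Alternating (fun i => (ofFactor ι₁ ι₂ i).range) ((inl ι₁ ι₂).comp ι₁).range i ys) :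
    ∃ w : CoprodI.Word (Factor G H), PushoutI.Reduced (toFactor ι₁ ι₂) w ∧
      PushoutI.ofCoprodI w.prod = toPushout ι₁ ι₂ ys.prod ∧
      w.fstIdx = ys.head?.map fun _ => i := by
  induction ys generalizing i with
  | nil => exact ⟨.empty, by simp [PushoutI.Reduced, CoprodI.Word.empty], by simp, rfl⟩
  | cons y ys ih =>
    obtain ⟨⟨⟨x, rfl⟩, hx⟩, hys⟩ := hys
    obtain ⟨w, hw, hprod, hidx⟩ := ih hys
    have hxr : x ∉ (toFactor ι₁ ι₂ i).range := by
      rintro ⟨a, rfl⟩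
      exact hx ⟨a, (ofFactor_toFactor a i).symm⟩
    have hne : w.fstIdx ≠ some i := by
      rw [hidx]
      cases ys <;> simp
    refine ⟨.cons x w hne fun h => hxr (h ▸ one_mem _), ?_, ?_, by simp⟩
    · intro g hg
      rcases List.mem_cons.1 hg with rfl | hg
      · exact hxr
      · exact hw g hg
    · rw [CoprodI.Word.prod_cons, map_mul, hprod, PushoutI.ofCoprodI_of, List.prod_cons, map_mul,
        toPushout_ofFactor]

theorem isAmalgam (hφ : ∀ i, Function.Injective (toFactor ι₁ ι₂ i)) :
    IsAmalgam (fun i => (ofFactor ι₁ ι₂ i).range) ((inl ι₁ ι₂).comp ι₁).range where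
  base_le i := by
    rintro _ ⟨a, rfl⟩
    exact ⟨_, ofFactor_toFactor a i⟩
  iSup_eq_top := by
    rw [eq_top_iff]
    rintro x -
    obtain ⟨x, rfl⟩ := QuotientGroup.mk'_surjective _ x
    induction x using Coprod.induction_on with
    | inl g => exact Subgroup.mem_iSup_of_mem true ⟨ULift.up g, rfl⟩
    | inr h => exact Subgroup.mem_iSup_of_mem false ⟨ULift.up h, rfl⟩
    | mul x y hx hy => rw [map_mul]; exact mul_mem hx hy
  prod_notMem i ys hys hne := by
    rintro ⟨a, ha⟩
    obtain ⟨w, hw, hprod, hidx⟩ := exists_reduced_word hys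
    have := hw.eq_empty_of_mem_range hφ ⟨a, by
      rw [hprod, ← ha, MonoidHom.comp_apply, ← ofFactor_toFactor a true, toPushout_ofFactor,
        PushoutI.of_apply_eq_base]⟩
    subst this
    obtain ⟨y, ys, rfl⟩ := List.exists_cons_of_ne_nil hne
    cases hidx

theorem exists_malnormal_notMem {B : Type*} [Group B] {φ : A →* B}
    (hns : ¬ Function.Surjective φ) (h : ∃ g, ∀ a, g⁻¹ * φ a * g ∈ φ.range → a = 1) :
    ∃ g, g ∉ φ.range ∧ ∀ a, g⁻¹ * φ a * g ∈ φ.range → a = 1 := by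
  obtain ⟨g, hg⟩ := h
  by_cases hgr : g ∈ φ.range
  · obtain ⟨g', hg'⟩ := not_forall.1 hns
    exact ⟨g', hg', fun a _ => hg a (mul_mem (mul_mem (inv_mem hgr) ⟨a, rfl⟩) hgr)⟩
  · exact ⟨g, hgr, hg⟩

theorem exists_malnormal_factor (hns₁ : ¬ Function.Surjective ι₁)
    (hns₂ : ¬ Function.Surjective ι₂) (hg : ∃ g, ∀ a, g⁻¹ * ι₁ a * g ∈ ι₁.range → a = 1)
    (hh : ∃ h, ∀ a, h⁻¹ * ι₂ a * h ∈ ι₂.range → a = 1) :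
    ∀ i, ∃ g, g ∉ (toFactor ι₁ ι₂ i).range ∧
      ∀ a, g⁻¹ * toFactor ι₁ ι₂ i a * g ∈ (toFactor ι₁ ι₂ i).range → a = 1
  | true => by
    obtain ⟨g, hg, hg'⟩ := exists_malnormal_notMem hns₁ hg
    exact ⟨ULift.up g, fun ⟨a, ha⟩ => hg ⟨a, congrArg ULift.down ha⟩,
      fun a ⟨b, hb⟩ => hg' a ⟨b, congrArg ULift.down hb⟩⟩
  | false => by
    obtain ⟨h, hh, hh'⟩ := exists_malnormal_notMem hns₂ hh
    exact ⟨ULift.up h, fun ⟨a, ha⟩ => hh ⟨a, congrArg ULift.down ha⟩,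
      fun a ⟨b, hb⟩ => hh' a ⟨b, congrArg ULift.down hb⟩⟩

theorem fg_factor [Group.FG G] [Group.FG H] : ∀ i, Group.FG (Factor G H i)
  | true => Group.fg_of_surjective (f := (MulEquiv.ulift (α := G)).symm.toMonoidHom)
      (MulEquiv.ulift (α := G)).symm.surjective
  | false => Group.fg_of_surjective (f := (MulEquiv.ulift (α := H)).symm.toMonoidHom)
      (MulEquiv.ulift (α := H)).symm.surjective

theorem exists_mem_ofFactor_range (hφ : ∀ i, Function.Injective (toFactor ι₁ ι₂ i)) {i : Bool}
    (h : ∃ g, g ∉ (toFactor ι₁ ι₂ i).range ∧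
      ∀ a, g⁻¹ * toFactor ι₁ ι₂ i a * g ∈ (toFactor ι₁ ι₂ i).range → a = 1) :
    ∃ x ∈ (ofFactor ι₁ ι₂ i).range, x ∉ ((inl ι₁ ι₂).comp ι₁).range ∧
      ∀ y ∈ ((inl ι₁ ι₂).comp ι₁).range, x⁻¹ * y * x ∈ ((inl ι₁ ι₂).comp ι₁).range → y = 1 := by
  obtain ⟨g, hg, hg'⟩ := h
  refine ⟨_, ⟨g, rfl⟩, (ofFactor_mem_base_iff hφ).not.2 hg, ?_⟩
  rintro _ ⟨a, rfl⟩ ha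
  rw [MonoidHom.comp_apply, ← ofFactor_toFactor a i, ← map_inv, ← map_mul, ← map_mul,
    ofFactor_mem_base_iff hφ] at ha
  rw [hg' a ha, map_one]

end AmalgamatedProduct

theorem decidableIn_image_of_isRegular {P Δ : Type*} [Group P] [Finite Δ] [Primcodable Δ]
    {e : FreeMonoid Δ →* P} {K : Bool → Subgroup P} {A : Subgroup P} (hKA : IsAmalgam K A)
    (he : Function.Surjective e) (hA : (A : Set P).Finite)
    (hM : ∀ T : Set P, T.Finite → DecidableIn e (Submonoid.closure T))
    (hfg : ∀ i, (K i).FG)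
    (hconj : ∀ i, ∃ h ∈ K i, h ∉ A ∧ ∀ a ∈ A, h⁻¹ * a * h ∈ A → a = 1)
    {L : Language Δ} (hL : L.IsRegular) :
    DecidableIn e ((fun v : List Δ => e (FreeMonoid.ofList v)) '' L) := by
  obtain ⟨σ, _, M, rfl⟩ := hL
  have hspell : ∀ x : P, ∃ l : List P, (∀ z ∈ l, ∃ i, z ∈ K i) ∧ l.prod = x := fun x => by
    have hx : x ∈ ⨆ i, K i := hKA.iSup_eq_top ▸ Subgroup.mem_top x
    induction hx using Subgroup.iSup_induction' with
    | hp i x hx =>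
      exact ⟨[x], fun z hz => ⟨i, List.mem_singleton.1 hz ▸ hx⟩, List.prod_singleton⟩
    | h1 => exact ⟨[], by simp, rfl⟩
    | hmul x y _ _ hx hy =>
      obtain ⟨l, hl, rfl⟩ := hx
      obtain ⟨m, hm, rfl⟩ := hy
      exact ⟨l ++ m, fun z hz => (List.mem_append.1 hz).elim (hl z) (hm z), List.prod_append⟩
  choose ℓ hℓK hℓ using fun d => hspell (e (FreeMonoid.of d))
  have hpath : ∀ s', DecidableIn e {x | LabelledPath (M.subdividedEdges ℓ)
      (M.start, ⟨[], .inl rfl⟩) x (s', ⟨[], .inl rfl⟩)} := fun s' =>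
    decidableIn_labelledPath hKA he hA hM hfg hconj M.finite_subdividedEdges
      (fun _ _ _ => DFA.mem_of_subdividedEdges ⟨true, one_mem _⟩ hℓK) _ _
  refine (ComputablePred.exists_finite fun s' =>
    (hpath s').and' (.const (s' ∈ M.accept))).of_eq fun w => ?_
  constructor
  · rintro ⟨s', h, hs'⟩
    obtain ⟨v, hv, rfl⟩ := (M.labelledPath_subdividedEdges_iff fun d => (hℓ d).symm) _ _ _ |>.1 h
    exact ⟨v, hs', hv⟩
  · rintro ⟨v, hv, h⟩
    exact ⟨_, (M.labelledPath_subdividedEdges_iff fun d => (hℓ d).symm) _ _ _ |>.2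
      ⟨v, h, rfl⟩, hv⟩

/-- For an amalgamated free product `G ∗_A H` over a finite group `A` which is a
proper subgroup of the finitely generated groups `G` and `H`, and which is
conjugated off itself by some `g ∈ G` and some `h ∈ H`, the submonoid membership
problem and the rational subset membership problem are recursively equivalent. -/
theorem amalg_submonoidMembership_iff_rationalSubsetMembership
    {A G H : Type*} [Group A] [Finite A] [Group G] [Group H]
    (hGfg : Group.FG G) (hHfg : Group.FG H)
    (ι₁ : A →* G) (ι₂ : A →* H)
    (hinj₁ : Function.Injective ι₁) (hinj₂ : Function.Injective ι₂)
    (hns₁ : ¬ Function.Surjective ι₁) (hns₂ : ¬ Function.Surjective ι₂)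
    (hg : ∃ g : G, ∀ a : A, g⁻¹ * ι₁ a * g ∈ ι₁.range → a = 1)
    (hh : ∃ h : H, ∀ a : A, h⁻¹ * ι₂ a * h ∈ ι₂.range → a = 1)
    {Δ : Type} [Fintype Δ] [DecidableEq Δ]
    (e : FreeMonoid Δ →* AmalgamatedProduct ι₁ ι₂) (he : Function.Surjective e) :
    (∀ W : Set (List Δ), W.Finite →
      ComputablePred (fun w : List Δ =>
        e (FreeMonoid.ofList w) ∈
          Submonoid.closure ((fun v : List Δ => e (FreeMonoid.ofList v)) '' W)))
    ↔ (∀ L : Language Δ, L.IsRegular →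
      ComputablePred (fun w : List Δ =>
        e (FreeMonoid.ofList w) ∈ (fun v : List Δ => e (FreeMonoid.ofList v)) '' L)) := by
  constructor
  · intro h L hL
    have hφ := AmalgamatedProduct.toFactor_injective hinj₁ hinj₂
    refine decidableIn_image_of_isRegular (AmalgamatedProduct.isAmalgam hφ) he (Set.finite_range _)
      (fun T hT => ?_) (fun i => ?_) (fun i => ?_) hL
    · choose f hf using he
      have hW : (fun v : List Δ => e (FreeMonoid.ofList v)) ''
          ((fun x => FreeMonoid.toList (f x)) '' T) = T := by
        simp [Set.image_image, hf]
      have := h _ (hT.image fun x => FreeMonoid.toList (f x))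
      rwa [hW] at this
    · rw [← Group.fg_iff_subgroup_fg]
      have := AmalgamatedProduct.fg_factor (G := G) (H := H) i
      exact Group.fg_range _
    · exact AmalgamatedProduct.exists_mem_ofFactor_range hφ
        (AmalgamatedProduct.exists_malnormal_factor hns₁ hns₂ hg hh i)
  · intro h W hW
    exact (h _ (Language.IsRegular.kstar_of_finite hW)).of_eq fun w =>
      Set.ext_iff.1 (image_kstar_eq_closure e W) _
end
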